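/- Let k be an algebraically closed field of characteristic p > 0, let G₁ and G₂ be arbitrary finite groups, and let M be a support τ-tilting kG₁-module. Then the induced module Ind_{G₁}^{G₁×G₂} M ≅ kG₂ ⊗_k M is a support τ-tilting k[G₁×G₂]-module. -/

import Mathlib

/-!
Common definitions: τ-tilting theory over a ring, blocks of group algebras,
conjugate modules and induced modules.

Since group algebras (and their blocks) are symmetric algebras, the
Auslander–Reiten translate is `τ = Ω²` computed via (minimal) projective covers;
τ-rigidity is formulated accordingly.  Support τ-tilting modules are formulated
via support τ-tilting pairs: `M` is support τ-tilting iff `M` is τ-rigid and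
there is a projective module `P` with `Hom(P, M) = 0` and `|M| + |P| = |Λ|`
(the number of simple modules), which is the standard equivalent
characterisation (Adachi–Iyama–Reiten, Prop. 2.3; Remark 2.2 of the paper).
-/

universe u

section GeneralDefs

variable (A : Type u) [Ring A]

/-- A module is indecomposable if it is nontrivial and has no nontrivial
direct sum decomposition. -/
def IsIndecModule (X : Type u) [AddCommGroup X] [Module A X] : Prop :=
  Nontrivial X ∧ ∀ U V : Submodule A X, IsCompl U V → U = ⊥ ∨ V = ⊥

/-- `|M|`: the number of isomorphism classes of indecomposable direct summands
of `M`. -/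
noncomputable def numIndec (M : Type u) [AddCommGroup M] [Module A M] : ℕ :=
  Nat.card (Quot fun
    (L L' : {L : Submodule A M // (∃ L'', IsCompl L L'') ∧ IsIndecModule A L}) =>
      Nonempty (L.1 ≃ₗ[A] L'.1))

/-- `|A|`: the number of isomorphism classes of simple `A`-modules. -/
noncomputable def numSimples : ℕ :=
  Nat.card (Quot fun (X Y : {X : ModuleCat.{u} A // IsSimpleModule A X}) =>
    Nonempty ((X.1 : Type u) ≃ₗ[A] (Y.1 : Type u)))

/-- The number of isomorphism classes of simple `A`-modules lying in the block
with block idempotent `b` (i.e. on which `b` acts as the identity). -/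
noncomputable def numSimplesIn (b : A) : ℕ :=
  Nat.card (Quot fun
    (X Y : {X : ModuleCat.{u} A //
        IsSimpleModule A X ∧ ∀ v : (X : Type u), b • v = v}) =>
      Nonempty ((X.1 : Type u) ≃ₗ[A] (Y.1 : Type u)))

/-- `π : P → M` is a projective cover: `P` is projective, `π` is surjective and
`ker π` is superfluous (i.e. `π` is an essential epimorphism). -/
def IsProjCover {P M : Type u} [AddCommGroup P] [Module A P]
    [AddCommGroup M] [Module A M] (π : P →ₗ[A] M) : Prop :=
  Module.Projective A P ∧ Function.Surjective π ∧
    ∀ N : Submodule A P, N ⊔ LinearMap.ker π = ⊤ → N = ⊤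

/-- `M` is τ-rigid: `Hom(M, τ M) = 0`, where for the symmetric algebras
considered here `τ M = Ω² M` is computed from minimal projective presentations:
for (any) projective cover `π₀ : P₀ → M` and projective cover
`π₁ : P₁ → ker π₀`, one has `τ M = ker π₁`. -/
def IsTauRigid (M : Type u) [AddCommGroup M] [Module A M] : Prop :=
  ∀ (P₀ : Type u) [AddCommGroup P₀] [Module A P₀] (π₀ : P₀ →ₗ[A] M),
    IsProjCover A π₀ →
    ∀ (P₁ : Type u) [AddCommGroup P₁] [Module A P₁]
      (π₁ : P₁ →ₗ[A] ↥(LinearMap.ker π₀)),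
      IsProjCover A π₁ →
      ∀ g : M →ₗ[A] ↥(LinearMap.ker π₁), g = 0

/-- `M` is a support τ-tilting `A`-module (via support τ-tilting pairs):
`M` is τ-rigid and there is a (finitely generated) projective `A`-module `P`
with `Hom_A(P, M) = 0` and `|M| + |P| = |A|`. -/
def IsSupportTauTilting (M : Type u) [AddCommGroup M] [Module A M] : Prop :=
  IsTauRigid A M ∧
  ∃ P : ModuleCat.{u} A, Module.Projective A P ∧ Module.Finite A P ∧
    (∀ f : (P : Type u) →ₗ[A] M, f = 0) ∧
    numIndec A M + numIndec A (P : Type u) = numSimples A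

/-- `b` is a block idempotent: a primitive central idempotent of `A`.
The corresponding block is `B = A * b`. -/
def IsBlockIdem (b : A) : Prop :=
  b ≠ 0 ∧ b * b = b ∧ (∀ r : A, b * r = r * b) ∧
  ∀ c : A, c * c = c → (∀ r : A, c * r = r * c) → b * c = c → c = 0 ∨ c = b

/-- `M` is a support τ-tilting module over the block `B` with block idempotent
`b`: `M` lies in `B`, is τ-rigid (over `B`, equivalently over `A`) and there is
a projective module `P` lying in `B` with `Hom(P, M) = 0` and
`|M| + |P| = |B|`. -/
def IsSupportTauTiltingBlock (b : A) (M : Type u) [AddCommGroup M]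
    [Module A M] : Prop :=
  (∀ m : M, b • m = m) ∧ IsTauRigid A M ∧
  ∃ P : ModuleCat.{u} A, Module.Projective A P ∧ Module.Finite A P ∧
    (∀ v : (P : Type u), b • v = v) ∧
    (∀ f : (P : Type u) →ₗ[A] M, f = 0) ∧
    numIndec A M + numIndec A (P : Type u) = numSimplesIn A b

/-- The partial order on support τ-tilting modules: `M ≥ M'` iff there are
`r > 0` and an epimorphism `M^{⊕ r} ↠ M'`. -/
def stGE (M M' : Type u) [AddCommGroup M] [Module A M]
    [AddCommGroup M'] [Module A M'] : Prop :=
  ∃ r : ℕ, 0 < r ∧ ∃ φ : (Fin r → M) →ₗ[A] M', Function.Surjective φ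

/-- `X ∈ add M`: `X` is a direct summand of a finite direct sum of copies
of `M`. -/
def InAdd (M X : Type u) [AddCommGroup M] [Module A M]
    [AddCommGroup X] [Module A X] : Prop :=
  ∃ (n : ℕ) (i : X →ₗ[A] (Fin n → M)) (p : (Fin n → M) →ₗ[A] X),
    p.comp i = LinearMap.id

/-- For a central idempotent `b` of `A`, the direct summand `b • N` of an
`A`-module `N`, realised as the submodule of elements on which `b` acts as the
identity. -/
def blockComponent (b : A) (hb : ∀ r : A, b * r = r * b)
    (N : Type u) [AddCommGroup N] [Module A N] : Submodule A N where
  carrier := {n | b • n = n}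
  add_mem' := by
    intro a c ha hc
    simp only [Set.mem_setOf_eq, smul_add] at *
    rw [ha, hc]
  zero_mem' := by simp
  smul_mem' := by
    intro r n hn
    simp only [Set.mem_setOf_eq] at *
    rw [← mul_smul, hb, mul_smul, hn]

end GeneralDefs

section InducedDefs

/-- `(N, j)` is the module induced from `M` along the ring homomorphism
`ι : R →+* S`, i.e. `N ≅ S ⊗_R M`, characterised by the universal property of
extension of scalars: `j : M → N` is `R`-linear (with `R` acting on `N` via
`ι`) and every `R`-linear map from `M` to (the restriction of) an `S`-module
`X` factors uniquely through an `S`-linear map `N → X`. -/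
def IsInducedMod {R S : Type u} [Ring R] [Ring S] (ι : R →+* S)
    (M : Type u) [AddCommGroup M] [Module R M]
    (N : Type u) [AddCommGroup N] [Module S N] (j : M →+ N) : Prop :=
  (∀ (r : R) (m : M), j (r • m) = ι r • j m) ∧
  ∀ (X : Type u) [AddCommGroup X] [Module S X] (f : M →+ X),
    (∀ (r : R) (m : M), f (r • m) = ι r • f m) →
    ∃! g : N →ₗ[S] X, ∀ m : M, g (j m) = f m

end InducedDefs

section GroupDefs

variable (k : Type u) [Field k] (Gt : Type u) [Group Gt] (G : Subgroup Gt)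
  [G.Normal]

/-- The ring automorphism of `kG` induced by conjugation by `x ∈ G̃` on the
normal subgroup `G`. -/
noncomputable def conjRingHom (x : Gt) :
    MonoidAlgebra k ↥G →+* MonoidAlgebra k ↥G :=
  MonoidAlgebra.mapDomainRingHom k (MulAut.conjNormal (H := G) x)

/-- The ring homomorphism `kG →+* kG̃` induced by the inclusion `G ≤ G̃`. -/
noncomputable def inclRingHom : MonoidAlgebra k ↥G →+* MonoidAlgebra k Gt :=
  MonoidAlgebra.mapDomainRingHom k G.subtype

/-- `x M ≅ M`: the conjugate module `x M` (with `g` acting as `x⁻¹ g x` does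
on `M`) is isomorphic to `M`; equivalently, there is an additive automorphism
of `M` which is semilinear for the conjugation automorphism of `kG`. -/
def IsConjStable (x : Gt) (M : Type u) [AddCommGroup M]
    [Module (MonoidAlgebra k ↥G) M] : Prop :=
  ∃ φ : M ≃+ M, ∀ (r : MonoidAlgebra k ↥G) (m : M),
    φ (conjRingHom k Gt G x r • m) = r • φ m

end GroupDefs

section Indecomposable

variable {R : Type u} [Ring R] {X Y M : Type u} [AddCommGroup X] [Module R X]
  [AddCommGroup Y] [Module R Y] [AddCommGroup M] [Module R M]

theorem LinearMap.isCompl_range_ker_of_bijective_comp (f : X →ₗ[R] Y) (g : Y →ₗ[R] X)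
    (h : Function.Bijective (g ∘ₗ f)) : IsCompl (LinearMap.range f) (LinearMap.ker g) := by
  constructor
  · rw [Submodule.disjoint_def]
    rintro _ ⟨x, rfl⟩ hx
    have : x = 0 := h.1 (by simpa using hx)
    simp [this]
  · rw [codisjoint_iff, eq_top_iff]
    intro y _
    obtain ⟨x, hx⟩ := h.2 (g y)
    rw [Submodule.mem_sup]
    exact ⟨f x, ⟨x, rfl⟩, y - f x, by simpa [sub_eq_zero] using hx.symm, by abel⟩

theorem IsIndecModule.bijective_of_bijective_comp [Nontrivial X] (hY : IsIndecModule R Y)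
    (f : X →ₗ[R] Y) (g : Y →ₗ[R] X) (h : Function.Bijective (g ∘ₗ f)) :
    Function.Bijective f := by
  have hf : Function.Injective f := Function.Injective.of_comp h.1
  refine ⟨hf, ?_⟩
  have hc := LinearMap.isCompl_range_ker_of_bijective_comp f g h
  rcases hY.2 _ _ hc with h0 | h0
  · obtain ⟨x, hx⟩ := exists_ne (0 : X)
    refine absurd (hf (a₁ := x) (a₂ := 0) ?_) hx
    have : f x ∈ LinearMap.range f := ⟨x, rfl⟩
    rw [h0] at this
    simpa using this
  · rw [h0] at hc
    exact LinearMap.range_eq_top.1 (by simpa using hc.sup_eq_top)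

theorem isIndecModule_of_isIdempotentElem [Nontrivial X]
    (h : ∀ e : Module.End R X, e * e = e → e = 0 ∨ e = 1) : IsIndecModule R X := by
  refine ⟨inferInstance, fun U V hUV => ?_⟩
  have hid : U.projection V hUV * U.projection V hUV = U.projection V hUV := by
    ext x
    exact Submodule.projection_apply_of_mem_left hUV (Submodule.projection_apply_mem hUV x)
  rcases h _ hid with h0 | h0
  · left
    rw [← Submodule.range_projection hUV, h0, LinearMap.range_zero]
  · right
    rw [← Submodule.ker_projection hUV, h0]
    exact LinearMap.ker_id

theorem IsIndecModule.eq_zero_or_eq_one (hX : IsIndecModule R X) (e : Module.End R X)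
    (he : e * e = e) : e = 0 ∨ e = 1 := by
  have hc : IsCompl (LinearMap.range e) (LinearMap.ker e) :=
    (LinearMap.IsIdempotentElem.isCompl (f := e) he)
  rcases hX.2 _ _ hc with h0 | h0
  · left; exact LinearMap.range_eq_bot.1 h0
  · right
    ext x
    exact LinearMap.ker_eq_bot.1 h0 (congrArg (fun f => f x) he)

theorem IsIndecModule.congr (hX : IsIndecModule R X) (φ : X ≃ₗ[R] Y) : IsIndecModule R Y := by
  have := hX.1
  have : Nontrivial Y := φ.symm.toEquiv.nontrivial
  refine isIndecModule_of_isIdempotentElem fun e he => ?_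
  rcases hX.eq_zero_or_eq_one (φ.symm.toLinearMap ∘ₗ e ∘ₗ φ.toLinearMap) (by
    ext x
    simpa using congrArg (fun f => f (φ x)) he) with h | h
  · left
    ext y
    simpa using congrArg (fun f => f (φ.symm y)) h
  · right
    ext y
    simpa [LinearEquiv.symm_apply_eq] using congrArg (fun f => f (φ.symm y)) h

theorem IsIndecModule.isNilpotent_or_isUnit (hX : IsIndecModule R X) [IsNoetherian R X]
    [IsArtinian R X] (f : Module.End R X) : IsNilpotent f ∨ IsUnit f := by
  obtain ⟨n, hn⟩ := Filter.eventually_atTop.1 (LinearMap.eventually_isCompl_ker_pow_range_pow f)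
  rcases hX.2 _ _ (hn (n + 1) (by omega)) with h0 | h0
  · right
    have hinj : Function.Injective f := by
      have := LinearMap.ker_eq_bot.1 h0
      rw [pow_succ, Module.End.mul_eq_comp] at this
      exact Function.Injective.of_comp this
    exact (Module.End.isUnit_iff f).2 (IsArtinian.bijective_of_injective_endomorphism f hinj)
  · left
    exact ⟨n + 1, LinearMap.range_eq_bot.1 h0⟩

theorem IsIndecModule.isLocalRing_end (hX : IsIndecModule R X) [IsNoetherian R X]
    [IsArtinian R X] : IsLocalRing (Module.End R X) := by
  have := hX.1
  refine ⟨fun {a b} hab => ?_⟩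
  rcases hX.isNilpotent_or_isUnit a with h | h
  · right
    rw [← eq_sub_iff_add_eq'] at hab
    rw [hab]
    exact h.isUnit_one_sub
  · exact Or.inl h

theorem IsLocalRing.isUnit_or_isUnit_of_isUnit_add_noncomm {S : Type*} [Ring S] [IsLocalRing S]
    {a b : S} (h : IsUnit (a + b)) : IsUnit a ∨ IsUnit b := by
  obtain ⟨u, hu⟩ := h
  have h1 : (↑u⁻¹ * a : S) + ↑u⁻¹ * b = 1 := by rw [← mul_add, ← hu]; simp
  rcases IsLocalRing.isUnit_or_isUnit_of_add_one h1 with h | h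
  · left; simpa using h
  · right; simpa using h

/-- If `1 ∈ End Y` is a sum of elements of `S`, then an indecomposable retract `X` of `Y`
survives some element of `S`. -/
theorem IsIndecModule.exists_isUnit_of_mem_closure (hX : IsIndecModule R X) [IsNoetherian R X]
    [IsArtinian R X] (i : X →ₗ[R] Y) (p : Y →ₗ[R] X) (hpi : p ∘ₗ i = LinearMap.id)
    {S : Set (Module.End R Y)} (hS : 1 ∈ AddSubmonoid.closure S) :
    ∃ x ∈ S, Function.Bijective (p ∘ₗ x ∘ₗ i) := by
  have := hX.isLocalRing_end
  have := hX.1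
  by_contra! hcon
  have key : ∀ x ∈ AddSubmonoid.closure S, ¬ IsUnit (p ∘ₗ x ∘ₗ i : Module.End R X) := by
    intro x hx
    induction hx using AddSubmonoid.closure_induction with
    | mem x hx => rw [Module.End.isUnit_iff]; exact hcon x hx
    | zero => simp
    | add x y _ _ hx hy =>
      intro h
      rw [LinearMap.add_comp, LinearMap.comp_add] at h
      rcases IsLocalRing.isUnit_or_isUnit_of_isUnit_add_noncomm h with h | h
      · exact hx h
      · exact hy h
  refine key 1 hS ?_
  rw [Module.End.one_eq_id, LinearMap.id_comp, hpi]
  exact isUnit_one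

/-- The idempotent endomorphisms projecting onto an indecomposable direct summand. -/
def indecIdempotents (R : Type u) [Ring R] (M : Type u) [AddCommGroup M] [Module R M] :
    Set (Module.End R M) :=
  {x | x * x = x ∧ IsIndecModule R (LinearMap.range x)}

theorem mem_closure_indecIdempotents [IsArtinian R M] (e : Module.End R M) (he : e * e = e) :
    e ∈ AddSubmonoid.closure (indecIdempotents R M) := by
  obtain ⟨U, hU⟩ : ∃ U, U = LinearMap.range e := ⟨_, rfl⟩
  induction U using WellFoundedLT.induction generalizing e with
  | ind U ih =>
  subst hU
  by_cases h0 : e = 0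
  · rw [h0]; exact zero_mem _
  by_cases hi : IsIndecModule R (LinearMap.range e)
  · exact AddSubmonoid.subset_closure ⟨he, hi⟩
  have : Nontrivial (LinearMap.range e) := by
    rw [Submodule.nontrivial_iff_ne_bot]
    exact fun h => h0 (LinearMap.range_eq_bot.1 h)
  have he' : ∀ x ∈ LinearMap.range e, e x = x := by
    rintro _ ⟨x, rfl⟩
    exact congrArg (fun f => f x) he
  have : ∃ c : Module.End R (LinearMap.range e), c * c = c ∧ c ≠ 0 ∧ c ≠ 1 := by
    by_contra! hcon
    exact hi (isIndecModule_of_isIdempotentElem fun c hc =>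
      or_iff_not_imp_left.2 (hcon c hc))
  obtain ⟨c, hc, hc0, hc1⟩ := this
  have key : ∀ d : Module.End R (LinearMap.range e), d * d = d → d ≠ 1 →
      (LinearMap.range e).subtype ∘ₗ d ∘ₗ e.rangeRestrict ∈
        AddSubmonoid.closure (indecIdempotents R M) := by
    intro d hd hd1
    have hr : ∀ y : LinearMap.range e, e.rangeRestrict y = y := fun y =>
      Subtype.ext (he' y y.2)
    refine ih (LinearMap.range ((LinearMap.range e).subtype ∘ₗ d ∘ₗ e.rangeRestrict)) ?_ _ ?_ rfl
    · refine lt_of_le_of_ne ?_ ?_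
      · rintro _ ⟨x, rfl⟩
        exact (d (e.rangeRestrict x)).2
      · intro hEq
        refine hd1 (LinearMap.ext fun y => ?_)
        have hy : (y : M) ∈ LinearMap.range
          ((LinearMap.range e).subtype ∘ₗ d ∘ₗ e.rangeRestrict) := by rw [hEq]; exact y.2
        obtain ⟨x, hx⟩ := hy
        have hx' : d (e.rangeRestrict x) = y := Subtype.ext hx
        rw [← hx']
        exact congrArg (fun f => f (e.rangeRestrict x)) hd
    · ext x
      simp only [Module.End.mul_apply, LinearMap.comp_apply, Submodule.subtype_apply, hr]
      exact congrArg (fun f => ((f (e.rangeRestrict x) : LinearMap.range e) : M)) hd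
  have hsum : e = (LinearMap.range e).subtype ∘ₗ c ∘ₗ e.rangeRestrict +
      (LinearMap.range e).subtype ∘ₗ (1 - c) ∘ₗ e.rangeRestrict := by
    ext x
    simp
  rw [hsum]
  refine add_mem (key c hc hc1) (key (1 - c) ?_ ?_)
  · exact IsIdempotentElem.one_sub (a := c) hc
  · intro h; exact hc0 (by simpa using h)

theorem one_mem_closure_indecIdempotents [IsArtinian R M] :
    1 ∈ AddSubmonoid.closure (indecIdempotents R M) :=
  mem_closure_indecIdempotents 1 (one_mul 1)

/-- The indecomposable direct summands of `M`. -/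
abbrev IndecSummand (R : Type u) [Ring R] (M : Type u) [AddCommGroup M] [Module R M] : Type u :=
  {L : Submodule R M // (∃ L'', IsCompl L L'') ∧ IsIndecModule R L}

theorem IndecSummand.exists_retraction (L : IndecSummand R M) :
    ∃ p : M →ₗ[R] L.1, p ∘ₗ L.1.subtype = LinearMap.id := by
  obtain ⟨⟨V, hV⟩, -⟩ := L.2
  exact ⟨L.1.projectionOnto V hV, Submodule.projectionOnto_comp_subtype hV⟩

theorem IsIndecModule.exists_indecSummand (hX : IsIndecModule R X) (i : X →ₗ[R] M)
    (p : M →ₗ[R] X) (hpi : p ∘ₗ i = LinearMap.id) :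
    ∃ L : IndecSummand R M, Nonempty (L.1 ≃ₗ[R] X) := by
  have hi : Function.Injective i := by
    refine Function.Injective.of_comp (f := p) ?_
    rw [← LinearMap.coe_comp, hpi]; exact Function.injective_id
  let φ : X ≃ₗ[R] LinearMap.range i := LinearEquiv.ofInjective i hi
  refine ⟨⟨LinearMap.range i, ⟨LinearMap.ker p,
    LinearMap.isCompl_range_ker_of_bijective_comp i p ?_⟩, hX.congr φ⟩, ⟨φ.symm⟩⟩
  rw [hpi]; exact Function.bijective_id

theorem exists_indecSummand_of_mem {x : Module.End R M} (hx : x ∈ indecIdempotents R M) :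
    ∃ L : IndecSummand R M, L.1 = LinearMap.range x :=
  ⟨⟨LinearMap.range x, ⟨_, LinearMap.IsIdempotentElem.isCompl (f := x) hx.1⟩, hx.2⟩, rfl⟩

/-- If the identity of `X` is a finite sum of endomorphisms factoring through the indecomposable
module `Y`, then the indecomposable module `X` is isomorphic to `Y`. -/
theorem IsIndecModule.nonempty_equiv_of_sum (hX : IsIndecModule R X) [IsNoetherian R X]
    [IsArtinian R X] (hY : IsIndecModule R Y) {ι : Type*} (s : Finset ι) (f : ι → X →ₗ[R] Y)
    (g : ι → Y →ₗ[R] X) (h : ∑ i ∈ s, g i ∘ₗ f i = LinearMap.id) : Nonempty (X ≃ₗ[R] Y) := by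
  have := hX.1
  obtain ⟨x, ⟨i, rfl⟩, hb⟩ := hX.exists_isUnit_of_mem_closure LinearMap.id LinearMap.id rfl
    (S := Set.range fun i => g i ∘ₗ f i) (by
      rw [Module.End.one_eq_id, ← h]
      exact sum_mem fun i _ => AddSubmonoid.subset_closure ⟨i, rfl⟩)
  exact ⟨LinearEquiv.ofBijective (f i) (hY.bijective_of_bijective_comp (f i) (g i) hb)⟩

end Indecomposable

section ProjectiveCover

variable {R : Type u} [Ring R]

theorem exists_isProjCover [IsArtinianRing R] (M : Type u) [AddCommGroup M] [Module R M]
    [Module.Finite R M] :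
    ∃ (P : ModuleCat.{u} R) (π : P →ₗ[R] M), Module.Finite R P ∧ IsProjCover R π := by
  obtain ⟨N₀, π, hπ⟩ := Module.Finite.exists_fin' R M
  obtain ⟨U, ⟨e, he, rfl, hs⟩, hmin⟩ := WellFounded.has_min
    (wellFounded_lt (α := Submodule R (Fin N₀ → R)))
    {U | ∃ e : Module.End R (Fin N₀ → R), e * e = e ∧ LinearMap.range e = U ∧
      Function.Surjective (π ∘ₗ e)} ⟨⊤, 1, one_mul 1, LinearMap.range_id, hπ⟩
  have he' : ∀ y : LinearMap.range e, e.rangeRestrict y = y := by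
    rintro ⟨_, x, rfl⟩
    exact Subtype.ext (congrArg (fun f => f x) he)
  have hproj : Module.Projective R (LinearMap.range e) :=
    Module.Projective.of_split (LinearMap.range e).subtype e.rangeRestrict (LinearMap.ext he')
  let ρ : LinearMap.range e →ₗ[R] M := π ∘ₗ (LinearMap.range e).subtype
  have hρ : Function.Surjective ρ := fun m => by
    obtain ⟨x, hx⟩ := hs m
    exact ⟨⟨e x, x, rfl⟩, hx⟩
  refine ⟨ModuleCat.of R (LinearMap.range e), ρ, ?_, hproj, hρ, ?_⟩
  · exact Module.Finite.range e
  intro N hN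
  have hNs : Function.Surjective (ρ ∘ₗ N.subtype) := fun m => by
    obtain ⟨u, hu⟩ := hρ m
    have : u ∈ N ⊔ LinearMap.ker ρ := by rw [hN]; trivial
    obtain ⟨a, ha, b, hb, rfl⟩ := Submodule.mem_sup.1 this
    exact ⟨⟨a, ha⟩, by simpa [LinearMap.mem_ker.1 hb] using hu⟩
  obtain ⟨h, hh⟩ := Module.projective_lifting_property (ρ ∘ₗ N.subtype) ρ hNs
  let f : Module.End R (LinearMap.range e) := N.subtype ∘ₗ h
  have hf : ∀ x, ρ (f x) = ρ x := fun x => congrArg (fun g => g x) hh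
  obtain ⟨n, hn⟩ := Filter.eventually_atTop.1 (LinearMap.eventually_isCompl_ker_pow_range_pow f)
  have hc := (hn (n + 1) (by omega)).symm
  set V := LinearMap.range (f ^ (n + 1)) with hV
  have hVN : V ≤ N := by
    rintro _ ⟨x, rfl⟩
    rw [pow_succ']
    exact (h _).2
  have hfp : ∀ (m : ℕ) (x), ρ ((f ^ m) x) = ρ x := fun m => by
    induction m with
    | zero => intro x; rfl
    | succ m ih => intro x; rw [pow_succ', Module.End.mul_apply, hf, ih]
  let e' : Module.End R (Fin N₀ → R) := (LinearMap.range e).subtype ∘ₗ V.projection _ hc ∘ₗ e.rangeRestrict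
  have he'V : ∀ v ∈ V, e' v = v := fun v hv => by
    change ((V.projection _ hc (e.rangeRestrict v) : LinearMap.range e) : Fin N₀ → R) = v
    rw [he', Submodule.projection_apply_of_mem_left hc hv]
  have hle : LinearMap.range e' ≤ LinearMap.range e := by
    rintro _ ⟨x, rfl⟩
    exact Subtype.coe_prop _
  have hnlt := hmin (LinearMap.range e') ⟨e', by
    refine LinearMap.ext fun x => ?_
    exact he'V _ (Submodule.projection_apply_mem hc _), rfl, fun m => by
      obtain ⟨u, hu⟩ := hρ m
      refine ⟨((f ^ (n + 1)) u : LinearMap.range e), ?_⟩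
      rw [LinearMap.comp_apply, he'V _ ⟨u, rfl⟩, ← hu]
      exact hfp (n + 1) u⟩
  have heq : LinearMap.range e' = LinearMap.range e :=
    by_contra fun hne => hnlt (lt_of_le_of_ne hle hne)
  rw [eq_top_iff]
  intro u _
  obtain ⟨x, hx⟩ : (u : Fin N₀ → R) ∈ LinearMap.range e' := by rw [heq]; exact u.2
  have : V.projection _ hc (e.rangeRestrict x) = u := Subtype.ext hx
  rw [← this]
  exact hVN (Submodule.projection_apply_mem hc _)

theorem IsProjCover.exists_equiv {P P' X X' : Type u} [AddCommGroup P] [Module R P]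
    [AddCommGroup P'] [Module R P'] [AddCommGroup X] [Module R X] [AddCommGroup X'] [Module R X']
    {π : P →ₗ[R] X} {π' : P' →ₗ[R] X'} (h : IsProjCover R π) (h' : IsProjCover R π')
    (φ : X ≃ₗ[R] X') : ∃ e : P ≃ₗ[R] P', ∀ x, π' (e x) = φ (π x) := by
  have := h.1
  have := h'.1
  obtain ⟨e, he⟩ := Module.projective_lifting_property π' (φ.toLinearMap ∘ₗ π) h'.2.1
  have he : ∀ x, π' (e x) = φ (π x) := fun x => congrArg (fun g => g x) he
  have hsurj : Function.Surjective e := by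
    rw [← LinearMap.range_eq_top]
    refine h'.2.2 _ (eq_top_iff.2 fun y _ => ?_)
    obtain ⟨x, hx⟩ := h.2.1 (φ.symm (π' y))
    exact Submodule.mem_sup.2 ⟨e x, ⟨x, rfl⟩, y - e x, by simp [he, hx], by abel⟩
  obtain ⟨s, hs⟩ := Module.projective_lifting_property e LinearMap.id hsurj
  have hs : ∀ y, e (s y) = y := fun y => congrArg (fun g => g y) hs
  have hsS : Function.Surjective s := by
    rw [← LinearMap.range_eq_top]
    refine h.2.2 _ (eq_top_iff.2 fun x _ => ?_)
    refine Submodule.mem_sup.2 ⟨s (e x), ⟨e x, rfl⟩, x - s (e x), ?_, by abel⟩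
    have : φ (π (x - s (e x))) = 0 := by rw [← he, map_sub, hs, sub_self, map_zero]
    exact (LinearEquiv.map_eq_zero_iff φ).1 this
  refine ⟨LinearEquiv.ofBijective e ⟨fun a b hab => ?_, hsurj⟩, he⟩
  obtain ⟨a, rfl⟩ := hsS a
  obtain ⟨b, rfl⟩ := hsS b
  rw [hs, hs] at hab
  rw [hab]

/-- τ-rigidity can be tested on a single minimal projective presentation. -/
theorem isTauRigid_of_isProjCover {X P₀ K P₁ : Type u} [AddCommGroup X] [Module R X]
    [AddCommGroup P₀] [Module R P₀] [AddCommGroup K] [Module R K] [AddCommGroup P₁] [Module R P₁]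
    (π₀ : P₀ →ₗ[R] X) (h₀ : IsProjCover R π₀) (κ : K →ₗ[R] P₀) (hκ : Function.Injective κ)
    (hκr : LinearMap.range κ = LinearMap.ker π₀) (π₁ : P₁ →ₗ[R] K) (h₁ : IsProjCover R π₁)
    (h : ∀ g : X →ₗ[R] P₁, π₁ ∘ₗ g = 0 → g = 0) : IsTauRigid R X := by
  intro P₀' _ _ π₀' h₀' P₁' _ _ π₁' h₁' g
  obtain ⟨e₀, he₀⟩ := h₀.exists_equiv h₀' (LinearEquiv.refl R X)
  have hker : ∀ x, e₀ x ∈ LinearMap.ker π₀' ↔ x ∈ LinearMap.ker π₀ := fun x => by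
    simp [he₀]
  let ψ : K →ₗ[R] LinearMap.ker π₀' := LinearMap.codRestrict _ (e₀.toLinearMap ∘ₗ κ) fun x =>
    (hker _).2 (hκr ▸ ⟨x, rfl⟩)
  let φ : K ≃ₗ[R] LinearMap.ker π₀' := LinearEquiv.ofBijective ψ
    ⟨fun a b hab => hκ (e₀.injective (congrArg Subtype.val hab)), fun y => by
      have : e₀.symm y ∈ LinearMap.range κ := by
        rw [hκr, ← hker]; simp
      obtain ⟨x, hx⟩ := this
      exact ⟨x, Subtype.ext (by simp [ψ, hx])⟩⟩
  obtain ⟨e₁, he₁⟩ := h₁'.exists_equiv h₁ φ.symm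
  have hz := h (e₁.toLinearMap ∘ₗ (LinearMap.ker π₁').subtype ∘ₗ g) (by
    ext x
    have : π₁' (g x) = 0 := (g x).2
    simp [he₁, this])
  ext1 x
  have hx := congrArg (fun f => f x) hz
  exact Subtype.ext (e₁.injective (by simpa using hx))

/-- A submodule `S` of `X` is superfluous if `U + S = X` forces `U = X`. -/
def IsSuperfluous {X : Type u} [AddCommGroup X] [Module R X] (S : Submodule R X) : Prop :=
  ∀ U : Submodule R X, U ⊔ S = ⊤ → U = ⊤

namespace IsSuperfluous

variable {X Y : Type u} [AddCommGroup X] [Module R X] [AddCommGroup Y] [Module R Y]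

theorem bot : IsSuperfluous (⊥ : Submodule R X) := fun U hU => by simpa using hU

theorem sup {S T : Submodule R X} (hS : IsSuperfluous S) (hT : IsSuperfluous T) :
    IsSuperfluous (S ⊔ T) := fun U hU => hS U (hT _ (by rwa [sup_assoc]))

theorem finset_sup {ι : Type*} (s : Finset ι) (S : ι → Submodule R X)
    (h : ∀ i ∈ s, IsSuperfluous (S i)) : IsSuperfluous (s.sup S) :=
  Finset.sup_induction bot (fun _ ha _ hb => ha.sup hb) h

theorem map {S : Submodule R X} (hS : IsSuperfluous S) (f : X →ₗ[R] Y) :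
    IsSuperfluous (S.map f) := by
  intro U hU
  have h1 : U.comap f = ⊤ := hS _ (eq_top_iff.2 fun x _ => by
    have : f x ∈ U ⊔ S.map f := by rw [hU]; trivial
    obtain ⟨a, ha, _, ⟨s, hs, rfl⟩, hx⟩ := Submodule.mem_sup.1 this
    refine Submodule.mem_sup.2 ⟨x - s, ?_, s, hs, by abel⟩
    rw [Submodule.mem_comap, map_sub, ← hx]
    simpa using ha)
  have h2 : S.map f ≤ U := Submodule.map_le_iff_le_comap.2 (h1 ▸ le_top)
  rwa [sup_eq_left.2 h2] at hU

end IsSuperfluous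

end ProjectiveCover

section Simples

variable {R : Type u} [Ring R]

/-- A relation that is total on both sides and matches equivalent elements induces a bijection of
quotients. -/
theorem Nat.card_quot_eq_of_rel {α : Type*} {β : Type*} {r : α → α → Prop} {s : β → β → Prop}
    (hr : Equivalence r) (hs : Equivalence s) (T : α → β → Prop)
    (hα : ∀ a, ∃ b, T a b) (hβ : ∀ b, ∃ a, T a b)
    (h : ∀ a a' b b', T a b → T a' b' → (r a a' ↔ s b b')) :
    Nat.card (Quot r) = Nat.card (Quot s) := by
  choose f hf using hα
  refine Nat.card_congr (Equiv.ofBijective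
    (Quot.map f fun a a' haa' => (h a a' _ _ (hf a) (hf a')).1 haa') ⟨?_, ?_⟩)
  · rintro ⟨a⟩ ⟨a'⟩ haa'
    exact Quot.sound ((h a a' _ _ (hf a) (hf a')).2 (hs.quot_mk_eq_iff _ _ |>.1 haa'))
  · rintro ⟨b⟩
    obtain ⟨a, ha⟩ := hβ b
    exact ⟨Quot.mk _ a, Quot.sound ((h a a _ _ (hf a) ha).1 (hr.refl a))⟩

theorem nonempty_linearEquiv_equivalence {α : Type*} (V : α → Type u)
    [∀ a, AddCommGroup (V a)] [∀ a, Module R (V a)] :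
    Equivalence fun a b => Nonempty (V a ≃ₗ[R] V b) :=
  ⟨fun _ => ⟨LinearEquiv.refl R _⟩, fun ⟨e⟩ => ⟨e.symm⟩, fun ⟨e⟩ ⟨f⟩ => ⟨e.trans f⟩⟩

variable {P Q S T : Type u} [AddCommGroup P] [Module R P] [AddCommGroup Q] [Module R Q]
  [AddCommGroup S] [Module R S] [AddCommGroup T] [Module R T]

theorem IsIndecModule.isUnit_of_comp_eq (hP : IsIndecModule R P) [IsNoetherian R P]
    [IsArtinian R P] [Nontrivial S] (π : P →ₗ[R] S) (hπ : Function.Surjective π)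
    (f : Module.End R P) (hf : ∀ x, π (f x) = π x) : IsUnit f := by
  refine (hP.isNilpotent_or_isUnit f).resolve_left ?_
  rintro ⟨n, hn⟩
  have hfp : ∀ (m : ℕ) (x), π ((f ^ m) x) = π x := fun m => by
    induction m with
    | zero => intro x; rfl
    | succ m ih => intro x; rw [pow_succ', Module.End.mul_apply, hf, ih]
  obtain ⟨s, hs⟩ := exists_ne (0 : S)
  obtain ⟨x, rfl⟩ := hπ s
  apply hs
  rw [← hfp n x, hn]
  simp

theorem IsIndecModule.nonempty_equiv_of_common_top (hP : IsIndecModule R P) [IsNoetherian R P]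
    [IsArtinian R P] [Module.Projective R P] (hQ : IsIndecModule R Q)
    [Module.Projective R Q] [Nontrivial S] (π : P →ₗ[R] S)
    (hπ : Function.Surjective π) (ρ : Q →ₗ[R] S) (hρ : Function.Surjective ρ) :
    Nonempty (P ≃ₗ[R] Q) := by
  have := hP.1
  obtain ⟨f, hf⟩ := Module.projective_lifting_property ρ π hρ
  obtain ⟨g, hg⟩ := Module.projective_lifting_property π ρ hπ
  have hu := hP.isUnit_of_comp_eq π hπ (g ∘ₗ f) fun x => by
    rw [← LinearMap.comp_apply, ← LinearMap.comp_assoc, hg, hf]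
  exact ⟨LinearEquiv.ofBijective f
    (hQ.bijective_of_bijective_comp f g ((Module.End.isUnit_iff _).1 hu))⟩

theorem IsIndecModule.nonempty_top_equiv (hP : IsIndecModule R P) [IsNoetherian R P]
    [IsArtinian R P] [Module.Projective R P] [IsSimpleModule R S] [IsSimpleModule R T]
    (π : P →ₗ[R] S) (hπ : Function.Surjective π) (ρ : P →ₗ[R] T) (hρ : Function.Surjective ρ) :
    Nonempty (S ≃ₗ[R] T) := by
  have hT := IsSimpleModule.nontrivial R T
  suffices hk : LinearMap.ker π = LinearMap.ker ρ from
    ⟨(π.quotKerEquivOfSurjective hπ).symm.trans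
      ((Submodule.quotEquivOfEq _ _ hk).trans (ρ.quotKerEquivOfSurjective hρ))⟩
  by_contra hne
  have hcπ : IsCoatom (LinearMap.ker π) := LinearMap.isCoatom_ker_of_surjective hπ
  have hcρ : IsCoatom (LinearMap.ker ρ) := LinearMap.isCoatom_ker_of_surjective hρ
  have hsup := hcπ.sup_eq_top_of_ne hcρ hne
  have hs : Function.Surjective (ρ ∘ₗ (LinearMap.ker π).subtype) := fun t => by
    obtain ⟨x, rfl⟩ := hρ t
    have : x ∈ LinearMap.ker π ⊔ LinearMap.ker ρ := by rw [hsup]; trivial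
    obtain ⟨a, ha, b, hb, rfl⟩ := Submodule.mem_sup.1 this
    exact ⟨⟨a, ha⟩, by simp [LinearMap.mem_ker.1 hb]⟩
  obtain ⟨h, hh⟩ := Module.projective_lifting_property _ ρ hs
  have hu := hP.isUnit_of_comp_eq ρ hρ ((LinearMap.ker π).subtype ∘ₗ h) fun x =>
    congrArg (fun g => g x) hh
  refine hcπ.1 (eq_top_iff.2 fun x _ => ?_)
  obtain ⟨y, rfl⟩ := ((Module.End.isUnit_iff _).1 hu).2 x
  exact (h y).2

theorem numSimples_eq_numIndec [IsArtinianRing R] : numSimples R = numIndec R R := by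
  refine (Nat.card_quot_eq_of_rel
    (nonempty_linearEquiv_equivalence fun L : IndecSummand R R => L.1)
    (nonempty_linearEquiv_equivalence
      fun X : {X : ModuleCat.{u} R // IsSimpleModule R X} => X.1)
    (fun L X => ∃ π : L.1 →ₗ[R] X.1, Function.Surjective π) ?_ ?_ ?_).symm
  · intro L
    have := L.2.2.1
    obtain ⟨m, hm, -⟩ := (eq_top_or_exists_le_coatom (⊥ : Submodule R L.1)).resolve_left
      bot_ne_top
    exact ⟨⟨ModuleCat.of R (L.1 ⧸ m), isSimpleModule_iff_isCoatom.2 hm⟩, m.mkQ, m.mkQ_surjective⟩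
  · rintro ⟨X, hX⟩
    have := IsSimpleModule.nontrivial R X
    obtain ⟨v, hv⟩ := exists_ne (0 : X)
    let π := LinearMap.toSpanSingleton R X v
    obtain ⟨x, hx, hne⟩ : ∃ x ∈ indecIdempotents R R, π ∘ₗ x ≠ 0 := by
      by_contra! hcon
      have key : ∀ x ∈ AddSubmonoid.closure (indecIdempotents R R), π ∘ₗ x = 0 := by
        intro x hx
        induction hx using AddSubmonoid.closure_induction with
        | mem x hx => exact hcon x hx
        | zero => simp
        | add x y _ _ hx hy => rw [LinearMap.comp_add, hx, hy, add_zero]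
      have h1 := congrArg (fun f => f 1) (key 1 one_mem_closure_indecIdempotents)
      exact hv (by simpa [π] using h1)
    obtain ⟨L, hL⟩ := exists_indecSummand_of_mem hx
    refine ⟨L, π ∘ₗ L.1.subtype, LinearMap.surjective_of_ne_zero fun h0 => hne ?_⟩
    ext
    have : x 1 ∈ L.1 := hL ▸ ⟨1, rfl⟩
    simpa using congrArg (fun f => f ⟨x 1, this⟩) h0
  · rintro L L' ⟨X, hX⟩ ⟨X', hX'⟩ ⟨π, hπ⟩ ⟨π', hπ'⟩
    obtain ⟨p, hp⟩ := L.exists_retraction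
    obtain ⟨p', hp'⟩ := L'.exists_retraction
    have : Module.Projective R L.1 := Module.Projective.of_split _ p hp
    have : Module.Projective R L'.1 := Module.Projective.of_split _ p' hp'
    have := IsSimpleModule.nontrivial R X'
    constructor
    · rintro ⟨e⟩
      exact L.2.2.nonempty_top_equiv π hπ (π' ∘ₗ e.toLinearMap) (hπ'.comp e.surjective)
    · rintro ⟨e⟩
      exact L.2.2.nonempty_equiv_of_common_top L'.2.2 (e.toLinearMap ∘ₗ π)
        (e.surjective.comp hπ) π' hπ'

end Simples

section OuterTensor

open TensorProduct MonoidAlgebra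

variable {k : Type u} [Field k] {G H : Type u} [Group G] [Group H]

section Module

variable (M P : Type u) [AddCommGroup M] [Module k M] [Module (MonoidAlgebra k G) M]
  [IsScalarTower k (MonoidAlgebra k G) M] [AddCommGroup P] [Module k P]
  [Module (MonoidAlgebra k H) P] [IsScalarTower k (MonoidAlgebra k H) P]

/-- The outer tensor product of a representation of `G` and a representation of `H`. -/
noncomputable def outerTensorRep : Representation k (G × H) (M ⊗[k] P) where
  toFun x := TensorProduct.map (Algebra.lsmul k k M (single x.1 (1 : k)))
    (Algebra.lsmul k k P (single x.2 (1 : k)))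
  map_one' := by
    ext
    simp [← MonoidAlgebra.one_def]
  map_mul' x y := by
    ext
    simp [smul_smul, MonoidAlgebra.single_mul_single]

/-- The outer tensor product of a `kG`-module and a `kH`-module as a `k[G × H]`-module. -/
noncomputable instance outerTensorModule : Module (MonoidAlgebra k (G × H)) (M ⊗[k] P) :=
  Module.compHom _ (outerTensorRep (G := G) (H := H) M P).asAlgebraHom.toRingHom

theorem outerTensor_smul_def (c : MonoidAlgebra k (G × H)) (x : M ⊗[k] P) :
    c • x = (outerTensorRep (G := G) (H := H) M P).asAlgebraHom c x := rfl

instance outerTensor_isScalarTower : IsScalarTower k (MonoidAlgebra k (G × H)) (M ⊗[k] P) :=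
  ⟨fun a c x => by simp [outerTensor_smul_def]⟩

end Module

variable {M P M' P' M'' P'' : Type u}
  [AddCommGroup M] [Module k M] [Module (MonoidAlgebra k G) M]
  [IsScalarTower k (MonoidAlgebra k G) M]
  [AddCommGroup M'] [Module k M'] [Module (MonoidAlgebra k G) M']
  [IsScalarTower k (MonoidAlgebra k G) M']
  [AddCommGroup M''] [Module k M''] [Module (MonoidAlgebra k G) M'']
  [IsScalarTower k (MonoidAlgebra k G) M'']
  [AddCommGroup P] [Module k P] [Module (MonoidAlgebra k H) P]
  [IsScalarTower k (MonoidAlgebra k H) P]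
  [AddCommGroup P'] [Module k P'] [Module (MonoidAlgebra k H) P']
  [IsScalarTower k (MonoidAlgebra k H) P']
  [AddCommGroup P''] [Module k P''] [Module (MonoidAlgebra k H) P'']
  [IsScalarTower k (MonoidAlgebra k H) P'']

@[simp]
theorem single_smul_outerTensor_tmul (g : G) (h : H) (m : M) (p : P) :
    (single (g, h) (1 : k) : MonoidAlgebra k (G × H)) • (m ⊗ₜ[k] p) =
      (single g (1 : k) • m) ⊗ₜ[k] (single h (1 : k) • p) := by
  simp [outerTensor_smul_def, outerTensorRep]

/-- The outer tensor product of module homomorphisms. -/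
noncomputable def outerTensorMap (f : M →ₗ[MonoidAlgebra k G] M')
    (g : P →ₗ[MonoidAlgebra k H] P') : M ⊗[k] P →ₗ[MonoidAlgebra k (G × H)] M' ⊗[k] P' :=
  equivariantOfLinearOfComm (TensorProduct.map (f.restrictScalars k) (g.restrictScalars k))
    fun x v => by
      induction v with
      | zero => simp
      | add v w hv hw => simp only [smul_add, map_add, hv, hw]
      | tmul m p => obtain ⟨a, b⟩ := x; simp

@[simp]
theorem outerTensorMap_tmul (f : M →ₗ[MonoidAlgebra k G] M') (g : P →ₗ[MonoidAlgebra k H] P')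
    (m : M) (p : P) : outerTensorMap f g (m ⊗ₜ[k] p) = f m ⊗ₜ[k] g p := rfl

theorem outerTensor_hom_ext {X : Type u} [AddCommGroup X] [Module (MonoidAlgebra k (G × H)) X]
    {f g : M ⊗[k] P →ₗ[MonoidAlgebra k (G × H)] X}
    (h : ∀ m p, f (m ⊗ₜ[k] p) = g (m ⊗ₜ[k] p)) : f = g := by
  ext x
  induction x with
  | zero => simp
  | add v w hv hw => simp only [map_add, hv, hw]
  | tmul m p => exact h m p

theorem outerTensorMap_id_id :
    outerTensorMap (LinearMap.id : M →ₗ[MonoidAlgebra k G] M)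
      (LinearMap.id : P →ₗ[MonoidAlgebra k H] P) = LinearMap.id :=
  outerTensor_hom_ext fun m p => by simp

theorem outerTensorMap_comp (f' : M' →ₗ[MonoidAlgebra k G] M'') (f : M →ₗ[MonoidAlgebra k G] M')
    (g' : P' →ₗ[MonoidAlgebra k H] P'') (g : P →ₗ[MonoidAlgebra k H] P') :
    outerTensorMap f' g' ∘ₗ outerTensorMap f g = outerTensorMap (f' ∘ₗ f) (g' ∘ₗ g) :=
  outerTensor_hom_ext fun m p => by simp

/-- The outer tensor product of module isomorphisms. -/
noncomputable def outerTensorEquiv (e : M ≃ₗ[MonoidAlgebra k G] M')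
    (f : P ≃ₗ[MonoidAlgebra k H] P') : M ⊗[k] P ≃ₗ[MonoidAlgebra k (G × H)] M' ⊗[k] P' :=
  LinearEquiv.ofLinearMap (outerTensorMap e.toLinearMap f.toLinearMap)
    (outerTensorMap e.symm.toLinearMap f.symm.toLinearMap)
    (outerTensor_hom_ext fun m p => by simp) (outerTensor_hom_ext fun m p => by simp)

/-- Contraction of the second tensor factor against a functional. -/
noncomputable def tensorContractRight (ξ : P →ₗ[k] k) : M ⊗[k] P →ₗ[k] M :=
  (TensorProduct.rid k M).toLinearMap ∘ₗ LinearMap.lTensor M ξ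

@[simp]
theorem tensorContractRight_tmul (ξ : P →ₗ[k] k) (m : M) (p : P) :
    tensorContractRight ξ (m ⊗ₜ[k] p) = ξ p • m := by simp [tensorContractRight]

/-- Contraction of the first tensor factor against a functional. -/
noncomputable def tensorContractLeft (ζ : M →ₗ[k] k) : M ⊗[k] P →ₗ[k] P :=
  (TensorProduct.lid k P).toLinearMap ∘ₗ LinearMap.rTensor P ζ

@[simp]
theorem tensorContractLeft_tmul (ζ : M →ₗ[k] k) (m : M) (p : P) :
    tensorContractLeft ζ (m ⊗ₜ[k] p) = ζ m • p := by simp [tensorContractLeft]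

theorem tensorContractRight_single_smul (ξ : P →ₗ[k] k) (g : G) (h : H) (x : M ⊗[k] P) :
    tensorContractRight ξ ((single (g, h) (1 : k) : MonoidAlgebra k (G × H)) • x) =
      single g (1 : k) • tensorContractRight (ξ ∘ₗ Algebra.lsmul k k P (single h (1 : k))) x := by
  induction x with
  | zero => simp
  | add v w hv hw => simp only [smul_add, map_add, hv, hw]
  | tmul m p =>
    simp only [single_smul_outerTensor_tmul, tensorContractRight_tmul, LinearMap.comp_apply,
      Algebra.lsmul_coe]
    exact (smul_algebra_smul_comm _ _ _).symm

theorem tensorContractLeft_single_smul (ζ : M →ₗ[k] k) (g : G) (h : H) (x : M ⊗[k] P) :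
    tensorContractLeft ζ ((single (g, h) (1 : k) : MonoidAlgebra k (G × H)) • x) =
      single h (1 : k) • tensorContractLeft (ζ ∘ₗ Algebra.lsmul k k M (single g (1 : k))) x := by
  induction x with
  | zero => simp
  | add v w hv hw => simp only [smul_add, map_add, hv, hw]
  | tmul m p =>
    simp only [single_smul_outerTensor_tmul, tensorContractLeft_tmul, LinearMap.comp_apply,
      Algebra.lsmul_coe]
    exact (smul_algebra_smul_comm _ _ _).symm

theorem sum_tensorContractRight_tmul {ι : Type*} [Fintype ι] (b : Module.Basis ι k P)
    (x : M ⊗[k] P) :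
    ∑ i, tensorContractRight (b.coord i) x ⊗ₜ[k] b i = x := by
  induction x with
  | zero => simp
  | add v w hv hw => simp only [map_add, add_tmul, Finset.sum_add_distrib, hv, hw]
  | tmul m p =>
    simp only [tensorContractRight_tmul, smul_tmul, ← tmul_sum, Module.Basis.coord_apply]
    rw [b.sum_repr]

theorem sum_tmul_tensorContractLeft {ι : Type*} [Fintype ι] (b : Module.Basis ι k M)
    (x : M ⊗[k] P) :
    ∑ i, b i ⊗ₜ[k] tensorContractLeft (b.coord i) x = x := by
  induction x with
  | zero => simp
  | add v w hv hw => simp only [map_add, tmul_add, Finset.sum_add_distrib, hv, hw]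
  | tmul m p =>
    simp only [tensorContractLeft_tmul, ← smul_tmul, ← sum_tmul, Module.Basis.coord_apply]
    rw [b.sum_repr]

theorem single_one_smul_tmul (g : G) (m : M) (p : P) :
    (single (g, (1 : H)) (1 : k) : MonoidAlgebra k (G × H)) • (m ⊗ₜ[k] p) =
      (single g (1 : k) • m) ⊗ₜ[k] p := by
  rw [single_smul_outerTensor_tmul, ← MonoidAlgebra.one_def, one_smul]

theorem one_single_smul_tmul (h : H) (m : M) (p : P) :
    (single ((1 : G), h) (1 : k) : MonoidAlgebra k (G × H)) • (m ⊗ₜ[k] p) =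
      m ⊗ₜ[k] (single h (1 : k) • p) := by
  rw [single_smul_outerTensor_tmul, ← MonoidAlgebra.one_def, one_smul]

/-- The `kG`-linear map `m ↦ (1 ⊗ ξ) (f (m ⊗ p))`. -/
noncomputable def sliceLeft (f : M ⊗[k] P →ₗ[MonoidAlgebra k (G × H)] M' ⊗[k] P') (p : P)
    (ξ : P' →ₗ[k] k) : M →ₗ[MonoidAlgebra k G] M' :=
  equivariantOfLinearOfComm
    (tensorContractRight ξ ∘ₗ f.restrictScalars k ∘ₗ (TensorProduct.mk k M P).flip p) fun g m => by
    have h1 : (Algebra.lsmul k k P' (single (1 : H) (1 : k))) = LinearMap.id := by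
      ext; simp [← MonoidAlgebra.one_def]
    simp only [LinearMap.comp_apply, LinearMap.flip_apply, TensorProduct.mk_apply,
      LinearMap.coe_restrictScalars]
    rw [← single_one_smul_tmul (H := H), map_smul, tensorContractRight_single_smul, h1,
      LinearMap.comp_id]

theorem sliceLeft_apply (f : M ⊗[k] P →ₗ[MonoidAlgebra k (G × H)] M' ⊗[k] P') (p : P)
    (ξ : P' →ₗ[k] k) (m : M) : sliceLeft f p ξ m = tensorContractRight ξ (f (m ⊗ₜ[k] p)) := rfl

/-- The `kH`-linear map `p ↦ (ζ ⊗ 1) (f (m ⊗ p))`. -/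
noncomputable def sliceRight (f : M ⊗[k] P →ₗ[MonoidAlgebra k (G × H)] M' ⊗[k] P') (m : M)
    (ζ : M' →ₗ[k] k) : P →ₗ[MonoidAlgebra k H] P' :=
  equivariantOfLinearOfComm
    (tensorContractLeft ζ ∘ₗ f.restrictScalars k ∘ₗ TensorProduct.mk k M P m) fun h p => by
    have h1 : (Algebra.lsmul k k M' (single (1 : G) (1 : k))) = LinearMap.id := by
      ext; simp [← MonoidAlgebra.one_def]
    simp only [LinearMap.comp_apply, TensorProduct.mk_apply, LinearMap.coe_restrictScalars]
    rw [← one_single_smul_tmul (G := G), map_smul, tensorContractLeft_single_smul, h1,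
      LinearMap.comp_id]

theorem sliceRight_apply (f : M ⊗[k] P →ₗ[MonoidAlgebra k (G × H)] M' ⊗[k] P') (m : M)
    (ζ : M' →ₗ[k] k) (p : P) : sliceRight f m ζ p = tensorContractLeft ζ (f (m ⊗ₜ[k] p)) := rfl

theorem sliceLeft_comp {ι : Type*} [Fintype ι] (b : Module.Basis ι k P')
    (g : M' ⊗[k] P' →ₗ[MonoidAlgebra k (G × H)] M'' ⊗[k] P'')
    (f : M ⊗[k] P →ₗ[MonoidAlgebra k (G × H)] M' ⊗[k] P') (p : P) (ξ : P'' →ₗ[k] k) :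
    sliceLeft (g ∘ₗ f) p ξ = ∑ i, sliceLeft g (b i) ξ ∘ₗ sliceLeft f p (b.coord i) := by
  ext m
  simp only [LinearMap.sum_apply, LinearMap.comp_apply, sliceLeft_apply]
  conv_lhs => rw [← sum_tensorContractRight_tmul b (f (m ⊗ₜ[k] p))]
  simp only [map_sum]

theorem sliceRight_comp {ι : Type*} [Fintype ι] (b : Module.Basis ι k M')
    (g : M' ⊗[k] P' →ₗ[MonoidAlgebra k (G × H)] M'' ⊗[k] P'')
    (f : M ⊗[k] P →ₗ[MonoidAlgebra k (G × H)] M' ⊗[k] P') (m : M) (ζ : M'' →ₗ[k] k) :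
    sliceRight (g ∘ₗ f) m ζ = ∑ i, sliceRight g (b i) ζ ∘ₗ sliceRight f m (b.coord i) := by
  ext p
  simp only [LinearMap.sum_apply, LinearMap.comp_apply, sliceRight_apply]
  conv_lhs => rw [← sum_tmul_tensorContractLeft b (f (m ⊗ₜ[k] p))]
  simp only [map_sum]

theorem exists_dual_eq_one [Nontrivial P] : ∃ (p : P) (ξ : P →ₗ[k] k), ξ p = 1 := by
  let b := Module.Free.chooseBasis k P
  have := b.index_nonempty
  obtain ⟨i⟩ := this
  exact ⟨b i, b.coord i, by simp⟩

end OuterTensor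

section Indecomposable

theorem IsIndecModule.exists_end_algHom {k : Type u} [Field k] [IsAlgClosed k] {A : Type u} [Ring A]
    [Algebra k A] {X : Type u} [AddCommGroup X] [Module k X] [Module A X] [IsScalarTower k A X]
    [FiniteDimensional k X] (hX : IsIndecModule A X) :
    ∃ χ : Module.End A X →ₐ[k] k, IsNilpotent (RingHom.ker χ) := by
  have := isNoetherian_of_tower (M := X) k (S := A) inferInstance
  have := isArtinian_of_tower (M := X) k (S := A) inferInstance
  have := hX.1
  have : Module.Finite k (Module.End A X) :=
    Module.Finite.of_injective (LinearMap.restrictScalarsₗ k A X X k)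
      (LinearMap.restrictScalars_injective k)
  have : IsArtinianRing (Module.End A X) := IsArtinianRing.of_finite k _
  have hmem : ∀ f : Module.End A X, ¬ IsUnit f → f ∈ Ring.jacobson (Module.End A X) := by
    intro f hf
    rw [← Ideal.jacobson_bot, Ideal.mem_jacobson_iff]
    intro y
    have hyf : ¬ IsUnit (y * f) := by
      intro h
      refine hf ((Module.End.isUnit_iff f).2
        (IsArtinian.bijective_of_injective_endomorphism f fun a b hab => ?_))
      exact ((Module.End.isUnit_iff _).1 h).1 (congrArg y hab)
    obtain ⟨u, hu⟩ := ((hX.isNilpotent_or_isUnit (y * f)).resolve_right hyf).isUnit_one_add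
    refine ⟨↑u⁻¹, ?_⟩
    have : (↑u⁻¹ : Module.End A X) * (1 + y * f) = 1 := by rw [← hu, Units.inv_mul]
    rw [Ideal.mem_bot, ← this, mul_add, mul_assoc]
    noncomm_ring
  have : Nontrivial (Module.End A X ⧸ Ring.jacobson (Module.End A X)) :=
    Ideal.Quotient.nontrivial_iff.2 (Ring.jacobson_lt_top _).ne
  have hsurj : Function.Bijective
      (algebraMap k (Module.End A X ⧸ Ring.jacobson (Module.End A X))) := by
    constructor
    · exact RingHom.injective _
    · intro q
      obtain ⟨f, rfl⟩ := Ideal.Quotient.mk_surjective q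
      obtain ⟨c, hc⟩ := Module.End.exists_eigenvalue (f.restrictScalars k : Module.End k X)
      refine ⟨c, ?_⟩
      rw [eq_comm, ← sub_eq_zero]
      change Ideal.Quotient.mk _ f - Ideal.Quotient.mk _ (algebraMap k (Module.End A X) c) = 0
      rw [← map_sub, Ideal.Quotient.eq_zero_iff_mem]
      apply hmem
      intro h
      obtain ⟨v, hv⟩ := hc.exists_hasEigenvector
      refine hv.2 (((Module.End.isUnit_iff _).1 h).1 ?_)
      have := hv.apply_eq_smul
      simp only [LinearMap.coe_restrictScalars] at this
      simp [this]
  let e := AlgEquiv.ofBijective (Algebra.ofId k _) hsurj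
  refine ⟨e.symm.toAlgHom.comp (Ideal.Quotient.mkₐ k _), ?_⟩
  obtain ⟨n, hn⟩ := IsSemiprimaryRing.isNilpotent (R := Module.End A X)
  refine ⟨n, eq_bot_iff.2 (le_trans (Ideal.pow_right_mono (fun f hf => ?_) n) hn.le)⟩
  have : e.symm (Ideal.Quotient.mk _ f) = 0 := hf
  rwa [EmbeddingLike.map_eq_zero_iff, Ideal.Quotient.eq_zero_iff_mem] at this

end Indecomposable

section OuterTensorIndecomposable

open TensorProduct MonoidAlgebra

variable {k : Type u} [Field k] {G H : Type u} [Group G] [Group H]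
  {M P M' P' : Type u}
  [AddCommGroup M] [Module k M] [Module (MonoidAlgebra k G) M]
  [IsScalarTower k (MonoidAlgebra k G) M]
  [AddCommGroup M'] [Module k M'] [Module (MonoidAlgebra k G) M']
  [IsScalarTower k (MonoidAlgebra k G) M']
  [AddCommGroup P] [Module k P] [Module (MonoidAlgebra k H) P]
  [IsScalarTower k (MonoidAlgebra k H) P]
  [AddCommGroup P'] [Module k P'] [Module (MonoidAlgebra k H) P']
  [IsScalarTower k (MonoidAlgebra k H) P']

instance TensorProduct.nontrivial_of_field [Nontrivial M] [Nontrivial P] :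
    Nontrivial (M ⊗[k] P) := by
  obtain ⟨m, ζ, hm⟩ := exists_dual_eq_one (k := k) (P := M)
  obtain ⟨q, ξ, hq⟩ := exists_dual_eq_one (k := k) (P := P)
  refine ⟨m ⊗ₜ q, 0, fun h => ?_⟩
  have := congrArg (fun x => ζ (tensorContractRight ξ x)) h
  simp [hq, hm] at this

theorem tensorContractRight_add (ξ ξ' : P →ₗ[k] k) (x : M ⊗[k] P) :
    tensorContractRight (ξ + ξ') x = tensorContractRight ξ x + tensorContractRight ξ' x := by
  simp [tensorContractRight, LinearMap.lTensor_add]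

theorem tensorContractRight_smul (c : k) (ξ : P →ₗ[k] k) (x : M ⊗[k] P) :
    tensorContractRight (c • ξ) x = c • tensorContractRight ξ x := by
  simp [tensorContractRight, LinearMap.lTensor_smul]

/-- `sliceLeft` as a bilinear map in the vector and the functional. -/
noncomputable def sliceLeftₗ (f : M ⊗[k] P →ₗ[MonoidAlgebra k (G × H)] M' ⊗[k] P') :
    P →ₗ[k] (P' →ₗ[k] k) →ₗ[k] (M →ₗ[MonoidAlgebra k G] M') :=
  LinearMap.mk₂ k (sliceLeft f)
    (fun p p' ξ => by ext; simp [sliceLeft_apply, tmul_add])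
    (fun c p ξ => by ext m; simp [sliceLeft_apply, LinearMap.map_smul_of_tower])
    (fun p ξ ξ' => by ext; simp [sliceLeft_apply, tensorContractRight_add])
    (fun c p ξ => by ext; simp [sliceLeft_apply, tensorContractRight_smul])

theorem sliceLeftₗ_apply (f : M ⊗[k] P →ₗ[MonoidAlgebra k (G × H)] M' ⊗[k] P') (p : P)
    (ξ : P' →ₗ[k] k) : sliceLeftₗ f p ξ = sliceLeft f p ξ := rfl

theorem sliceLeft_id (p : P) (ξ : P →ₗ[k] k) :
    sliceLeft (LinearMap.id : M ⊗[k] P →ₗ[MonoidAlgebra k (G × H)] M ⊗[k] P) p ξ =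
      ξ p • LinearMap.id := by
  ext m
  simp [sliceLeft_apply]

theorem sliceRight_id (m : M) (ζ : M →ₗ[k] k) :
    sliceRight (LinearMap.id : M ⊗[k] P →ₗ[MonoidAlgebra k (G × H)] M ⊗[k] P) m ζ =
      ζ m • LinearMap.id := by
  ext p
  simp [sliceRight_apply]

theorem sliceLeft_single_smul (f : M ⊗[k] P →ₗ[MonoidAlgebra k (G × H)] M' ⊗[k] P') (h : H)
    (p : P) (ξ : P' →ₗ[k] k) :
    sliceLeft f (single h (1 : k) • p) ξ =
      sliceLeft f p (ξ ∘ₗ Algebra.lsmul k k P' (single h (1 : k))) := by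
  ext m
  rw [sliceLeft_apply, ← one_single_smul_tmul (G := G), map_smul, tensorContractRight_single_smul,
    ← MonoidAlgebra.one_def, one_smul, sliceLeft_apply]

theorem eq_zero_of_isNilpotent_slices [FiniteDimensional k P]
    {J : Ideal (Module.End (MonoidAlgebra k G) M)} [J.IsTwoSided] (hJ : IsNilpotent J)
    {e : Module.End (MonoidAlgebra k (G × H)) (M ⊗[k] P)} (he : e * e = e)
    (hs : ∀ p ξ, sliceLeft e p ξ ∈ J) : e = 0 := by
  let b := Module.finBasis k P
  let W : ℕ → AddSubmonoid (M ⊗[k] P) := fun n =>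
    AddSubmonoid.closure {x | ∃ f ∈ J ^ n, ∃ m p, f m ⊗ₜ[k] p = x}
  have hstep : ∀ n, ∀ x ∈ W n, e x ∈ W (n + 1) := by
    intro n x hx
    induction hx using AddSubmonoid.closure_induction with
    | zero => simp
    | add x y _ _ hx hy => rw [map_add]; exact add_mem hx hy
    | mem x hx =>
      obtain ⟨f, hf, m, p, rfl⟩ := hx
      rw [← sum_tensorContractRight_tmul b (e (f m ⊗ₜ[k] p))]
      refine sum_mem fun i _ => AddSubmonoid.subset_closure
        ⟨sliceLeft e p (b.coord i) * f, ?_, m, b i, rfl⟩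
      rw [Ideal.IsTwoSided.pow_succ]
      exact Ideal.mul_mem_mul (hs _ _) hf
  have hall : ∀ n x, e x ∈ W n := by
    intro n
    induction n with
    | zero =>
      intro x
      generalize e x = y
      induction y with
      | zero => simp
      | add x y hx hy => exact add_mem hx hy
      | tmul m p => exact AddSubmonoid.subset_closure ⟨1, by rw [Submodule.pow_zero, Ideal.one_eq_top]; trivial, m, p, rfl⟩
    | succ n ih =>
      intro x
      rw [← he]
      exact hstep n _ (ih x)
  obtain ⟨n, hn⟩ := hJ
  ext x
  have h := hall n x
  have hW : W n ≤ ⊥ := by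
    refine AddSubmonoid.closure_le.2 ?_
    rintro _ ⟨f, hf, m, p, rfl⟩
    rw [hn] at hf
    rw [show f = 0 from hf]
    simp
  exact hW h

theorem IsIndecModule.outerTensor [IsAlgClosed k] [FiniteDimensional k M] [FiniteDimensional k P]
    (hM : IsIndecModule (MonoidAlgebra k G) M) (hP : IsIndecModule (MonoidAlgebra k H) P) :
    IsIndecModule (MonoidAlgebra k (G × H)) (M ⊗[k] P) := by
  have := hM.1
  have := hP.1
  obtain ⟨χ, hχ⟩ := hM.exists_end_algHom (k := k)
  refine isIndecModule_of_isIdempotentElem fun e he => ?_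
  let B : P →ₗ[k] Module.Dual k (Module.Dual k P) :=
    (LinearMap.compRight k χ.toLinearMap) ∘ₗ sliceLeftₗ e
  let Λ₀ : P →ₗ[k] P := (Module.evalEquiv k P).symm.toLinearMap ∘ₗ B
  have hΛ₀ : ∀ (ξ : Module.Dual k P) p, ξ (Λ₀ p) = χ (sliceLeft e p ξ) := fun ξ p =>
    Module.apply_evalEquiv_symm_apply k P ξ (B p)
  have hsep : ∀ p q : P, (∀ ξ : Module.Dual k P, ξ p = ξ q) → p = q := fun p q h =>
    (Module.evalEquiv k P).injective (LinearMap.ext h)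
  let Λ : Module.End (MonoidAlgebra k H) P := equivariantOfLinearOfComm Λ₀ fun h p =>
    hsep _ _ fun ξ => by
      rw [hΛ₀, sliceLeft_single_smul, ← hΛ₀]
      rfl
  have hΛ : ∀ (ξ : Module.Dual k P) p, ξ (Λ p) = χ (sliceLeft e p ξ) := hΛ₀
  have hΛΛ : Λ * Λ = Λ := by
    ext p
    refine hsep _ _ fun ξ => ?_
    let b := Module.finBasis k P
    rw [hΛ ξ p]
    conv_rhs => rw [← he]
    rw [Module.End.mul_eq_comp, Module.End.mul_eq_comp, sliceLeft_comp b, LinearMap.comp_apply, hΛ,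
      ← b.sum_repr (Λ p), ← sliceLeftₗ_apply]
    simp only [map_sum, map_smul, LinearMap.sum_apply, LinearMap.smul_apply]
    refine Finset.sum_congr rfl fun i _ => ?_
    rw [← Module.Basis.coord_apply, hΛ, ← Module.End.mul_eq_comp, map_mul, smul_eq_mul, mul_comm,
      sliceLeftₗ_apply]
  rcases hP.eq_zero_or_eq_one Λ hΛΛ with h | h
  · left
    refine eq_zero_of_isNilpotent_slices hχ he fun p ξ => ?_
    rw [RingHom.mem_ker, ← hΛ, h]
    simp
  · right
    refine (sub_eq_zero.1 (eq_zero_of_isNilpotent_slices hχ (e := 1 - e) ?_ fun p ξ => ?_)).symm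
    · rw [mul_sub, sub_mul, sub_mul, he]; simp
    · have : sliceLeft (1 - e) p ξ = ξ p • 1 - sliceLeft e p ξ := by
        ext m
        simp [sliceLeft_apply]
      rw [this, RingHom.mem_ker, map_sub, map_smul, map_one, ← hΛ, h]
      simp

end OuterTensorIndecomposable

section Counting

theorem numIndec_congr {R : Type u} [Ring R] {M N : Type u} [AddCommGroup M] [Module R M]
    [AddCommGroup N] [Module R N] (φ : M ≃ₗ[R] N) : numIndec R M = numIndec R N := by
  refine Nat.card_quot_eq_of_rel (nonempty_linearEquiv_equivalence _)
    (nonempty_linearEquiv_equivalence _)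
    (fun (L : IndecSummand R M) (L' : IndecSummand R N) => Nonempty (L.1 ≃ₗ[R] L'.1)) ?_ ?_ ?_
  · intro L
    obtain ⟨p, hp⟩ := IndecSummand.exists_retraction L
    obtain ⟨L', ⟨e⟩⟩ := L.2.2.exists_indecSummand (φ.toLinearMap ∘ₗ L.1.subtype)
      (p ∘ₗ φ.symm.toLinearMap) (by
        ext x; simpa using congrArg Subtype.val (LinearMap.congr_fun hp x))
    exact ⟨L', ⟨e.symm⟩⟩
  · intro L
    obtain ⟨p, hp⟩ := IndecSummand.exists_retraction L
    exact L.2.2.exists_indecSummand (φ.symm.toLinearMap ∘ₗ L.1.subtype)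
      (p ∘ₗ φ.toLinearMap) (by
        ext x; simpa using congrArg Subtype.val (LinearMap.congr_fun hp x))
  · rintro a a' b b' ⟨e⟩ ⟨e'⟩
    exact ⟨fun ⟨f⟩ => ⟨e.symm.trans (f.trans e')⟩, fun ⟨f⟩ => ⟨e.trans (f.trans e'.symm)⟩⟩

theorem Nat.card_quot_prod {α β : Type*} {r : α → α → Prop} {s : β → β → Prop}
    (hr : Equivalence r) (hs : Equivalence s) :
    Nat.card (Quot fun x y : α × β => r x.1 y.1 ∧ s x.2 y.2) =
      Nat.card (Quot r) * Nat.card (Quot s) := by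
  rw [← Nat.card_prod]
  exact Nat.card_congr (Setoid.prodQuotientEquiv ⟨r, hr⟩ ⟨s, hs⟩).symm

open TensorProduct MonoidAlgebra

variable {k : Type u} [Field k] {G H : Type u} [Group G] [Group H]
  {M P M' P' : Type u}
  [AddCommGroup M] [Module k M] [Module (MonoidAlgebra k G) M]
  [IsScalarTower k (MonoidAlgebra k G) M]
  [AddCommGroup M'] [Module k M'] [Module (MonoidAlgebra k G) M']
  [IsScalarTower k (MonoidAlgebra k G) M']
  [AddCommGroup P] [Module k P] [Module (MonoidAlgebra k H) P]
  [IsScalarTower k (MonoidAlgebra k H) P]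
  [AddCommGroup P'] [Module k P'] [Module (MonoidAlgebra k H) P']
  [IsScalarTower k (MonoidAlgebra k H) P']

theorem IsIndecModule.nonempty_equiv_of_outerTensor_left [FiniteDimensional k M]
    [FiniteDimensional k P'] [Nontrivial P]
    (hM : IsIndecModule (MonoidAlgebra k G) M) (hM' : IsIndecModule (MonoidAlgebra k G) M')
    (φ : M ⊗[k] P ≃ₗ[MonoidAlgebra k (G × H)] M' ⊗[k] P') :
    Nonempty (M ≃ₗ[MonoidAlgebra k G] M') := by
  have := isNoetherian_of_tower (M := M) k (S := MonoidAlgebra k G) inferInstance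
  have := isArtinian_of_tower (M := M) k (S := MonoidAlgebra k G) inferInstance
  obtain ⟨q, ξ, hq⟩ := exists_dual_eq_one (k := k) (P := P)
  let b := Module.finBasis k P'
  refine hM.nonempty_equiv_of_sum hM' Finset.univ (fun i => sliceLeft φ.toLinearMap q (b.coord i))
    (fun i => sliceLeft φ.symm.toLinearMap (b i) ξ) ?_
  rw [← sliceLeft_comp, LinearEquiv.symm_comp, sliceLeft_id, hq, one_smul]

theorem IsIndecModule.nonempty_equiv_of_outerTensor_right [FiniteDimensional k P]
    [FiniteDimensional k M'] [Nontrivial M]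
    (hP : IsIndecModule (MonoidAlgebra k H) P) (hP' : IsIndecModule (MonoidAlgebra k H) P')
    (φ : M ⊗[k] P ≃ₗ[MonoidAlgebra k (G × H)] M' ⊗[k] P') :
    Nonempty (P ≃ₗ[MonoidAlgebra k H] P') := by
  have := isNoetherian_of_tower (M := P) k (S := MonoidAlgebra k H) inferInstance
  have := isArtinian_of_tower (M := P) k (S := MonoidAlgebra k H) inferInstance
  obtain ⟨m, ζ, hm⟩ := exists_dual_eq_one (k := k) (P := M)
  let b := Module.finBasis k M'
  refine hP.nonempty_equiv_of_sum hP' Finset.univ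
    (fun i => sliceRight φ.toLinearMap m (b.coord i))
    (fun i => sliceRight φ.symm.toLinearMap (b i) ζ) ?_
  rw [← sliceRight_comp, LinearEquiv.symm_comp, sliceRight_id, hm, one_smul]

theorem outerTensorMap_mem_closure {x : Module.End (MonoidAlgebra k G) M}
    {y : Module.End (MonoidAlgebra k H) P} {S : Set (Module.End (MonoidAlgebra k G) M)}
    {T : Set (Module.End (MonoidAlgebra k H) P)} (hx : x ∈ AddSubmonoid.closure S)
    (hy : y ∈ AddSubmonoid.closure T) :
    (outerTensorMap x y : Module.End (MonoidAlgebra k (G × H)) (M ⊗[k] P)) ∈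
      AddSubmonoid.closure (Set.image2 (fun a b => outerTensorMap a b) S T) := by
  induction hx using AddSubmonoid.closure_induction with
  | zero =>
    rw [show outerTensorMap (0 : Module.End (MonoidAlgebra k G) M) y = 0 from
      outerTensor_hom_ext fun m p => by simp]
    exact zero_mem _
  | add a b _ _ ha hb =>
    rw [show outerTensorMap (a + b) y = outerTensorMap a y + outerTensorMap b y from
      outerTensor_hom_ext fun m p => by simp [add_tmul]]
    exact add_mem ha hb
  | mem a ha =>
    induction hy using AddSubmonoid.closure_induction with
    | zero =>
      rw [show outerTensorMap a (0 : Module.End (MonoidAlgebra k H) P) = 0 from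
        outerTensor_hom_ext fun m p => by simp]
      exact zero_mem _
    | add b c _ _ hb hc =>
      rw [show outerTensorMap a (b + c) = outerTensorMap a b + outerTensorMap a c from
        outerTensor_hom_ext fun m p => by simp [tmul_add]]
      exact add_mem hb hc
    | mem b hb => exact AddSubmonoid.subset_closure ⟨a, ha, b, hb, rfl⟩

theorem numIndec_outerTensor [IsAlgClosed k] [FiniteDimensional k M] [FiniteDimensional k P] :
    numIndec (MonoidAlgebra k (G × H)) (M ⊗[k] P) =
      numIndec (MonoidAlgebra k G) M * numIndec (MonoidAlgebra k H) P := by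
  have := isArtinian_of_tower (M := M) k (S := MonoidAlgebra k G) inferInstance
  have := isArtinian_of_tower (M := P) k (S := MonoidAlgebra k H) inferInstance
  have := isNoetherian_of_tower (M := M ⊗[k] P) k (S := MonoidAlgebra k (G × H)) inferInstance
  have := isArtinian_of_tower (M := M ⊗[k] P) k (S := MonoidAlgebra k (G × H)) inferInstance
  have hfM : ∀ L : Submodule (MonoidAlgebra k G) M, FiniteDimensional k L := fun L =>
    FiniteDimensional.finiteDimensional_submodule (L.restrictScalars k)
  have hfP : ∀ L : Submodule (MonoidAlgebra k H) P, FiniteDimensional k L := fun L =>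
    FiniteDimensional.finiteDimensional_submodule (L.restrictScalars k)
  have hrM := nonempty_linearEquiv_equivalence (R := MonoidAlgebra k G)
    fun L : IndecSummand (MonoidAlgebra k G) M => L.1
  have hrP := nonempty_linearEquiv_equivalence (R := MonoidAlgebra k H)
    fun L : IndecSummand (MonoidAlgebra k H) P => L.1
  unfold numIndec
  rw [← Nat.card_quot_prod hrM hrP]
  symm
  refine Nat.card_quot_eq_of_rel ⟨fun x => ⟨hrM.refl _, hrP.refl _⟩,
      fun h => ⟨hrM.symm h.1, hrP.symm h.2⟩,
      fun h h' => ⟨hrM.trans h.1 h'.1, hrP.trans h.2 h'.2⟩⟩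
    (nonempty_linearEquiv_equivalence _)
    (fun (L : IndecSummand (MonoidAlgebra k G) M × IndecSummand (MonoidAlgebra k H) P)
      (Z : IndecSummand (MonoidAlgebra k (G × H)) (M ⊗[k] P)) =>
      Nonempty (Z.1 ≃ₗ[MonoidAlgebra k (G × H)] (L.1.1 ⊗[k] L.2.1))) ?_ ?_ ?_
  · rintro ⟨L, Q⟩
    obtain ⟨p, hp⟩ := IndecSummand.exists_retraction L
    obtain ⟨q, hq⟩ := Q.exists_retraction
    refine (L.2.2.outerTensor Q.2.2).exists_indecSummand
      (outerTensorMap L.1.subtype Q.1.subtype) (outerTensorMap p q) ?_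
    rw [outerTensorMap_comp, hp, hq, outerTensorMap_id_id]
  · intro Z
    obtain ⟨p, hp⟩ := IndecSummand.exists_retraction Z
    have h1 := outerTensorMap_mem_closure
      (one_mem_closure_indecIdempotents (R := MonoidAlgebra k G) (M := M))
      (one_mem_closure_indecIdempotents (R := MonoidAlgebra k H) (M := P))
    have h1' : (outerTensorMap (1 : Module.End (MonoidAlgebra k G) M)
      (1 : Module.End (MonoidAlgebra k H) P)) = 1 := outerTensorMap_id_id
    rw [h1'] at h1
    obtain ⟨_, ⟨x, hx, y, hy, rfl⟩, hb⟩ := Z.2.2.exists_isUnit_of_mem_closure Z.1.subtype p hp h1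
    obtain ⟨L, hL⟩ := exists_indecSummand_of_mem hx
    obtain ⟨Q, hQ⟩ := exists_indecSummand_of_mem hy
    have := Z.2.2.1
    have hfac : outerTensorMap x y =
        outerTensorMap (LinearMap.range x).subtype (LinearMap.range y).subtype ∘ₗ
          outerTensorMap x.rangeRestrict y.rangeRestrict := by
      rw [outerTensorMap_comp]; rfl
    have hbij := (hx.2.outerTensor hy.2).bijective_of_bijective_comp
      (outerTensorMap x.rangeRestrict y.rangeRestrict ∘ₗ Z.1.subtype)
      (p ∘ₗ outerTensorMap (LinearMap.range x).subtype (LinearMap.range y).subtype) (by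
        simpa only [hfac, LinearMap.comp_assoc] using hb)
    exact ⟨(L, Q), ⟨(LinearEquiv.ofBijective _ hbij).trans
      (outerTensorEquiv (LinearEquiv.ofEq _ _ hL.symm) (LinearEquiv.ofEq _ _ hQ.symm))⟩⟩
  · rintro ⟨L, Q⟩ ⟨L', Q'⟩ Z Z' ⟨e⟩ ⟨e'⟩
    have := L.2.2.1
    have := Q.2.2.1
    constructor
    · rintro ⟨⟨f⟩, ⟨g⟩⟩
      exact ⟨e.trans ((outerTensorEquiv f g).trans e'.symm)⟩
    · rintro ⟨f⟩
      let φ := e.symm.trans (f.trans e')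
      exact ⟨L.2.2.nonempty_equiv_of_outerTensor_left L'.2.2 φ,
        Q.2.2.nonempty_equiv_of_outerTensor_right Q'.2.2 φ⟩

end Counting

section RegularOuterTensor

open TensorProduct MonoidAlgebra

variable {k : Type u} [Field k] {G H : Type u} [Group G] [Group H]

local notation "ι₁" => mapDomainRingHom k (MonoidHom.inl G H)

local notation "ι₂" => mapDomainRingHom k (MonoidHom.inr G H)

theorem mapDomainRingHom_smul' {K L : Type u} [Group K] [Group L] (f : K →* L) (c : k)
    (a : MonoidAlgebra k K) : mapDomainRingHom k f (c • a) = c • mapDomainRingHom k f a :=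
  mapDomain_smul _ _ _

theorem mapDomainRingHom_inl_mul_inr (a : MonoidAlgebra k G) (b : MonoidAlgebra k H) :
    ι₁ a * ι₂ b = ι₂ b * ι₁ a := by
  induction a using MonoidAlgebra.induction_linear with
  | zero => simp
  | add x y hx hy => simp only [map_add, add_mul, mul_add, hx, hy]
  | single g r =>
    induction b using MonoidAlgebra.induction_linear with
    | zero => simp
    | add x y hx hy => simp only [map_add, add_mul, mul_add, hx, hy]
    | single h s => simp [mapDomain_single, single_mul_single, mul_comm]

variable {M P M' : Type u}
  [AddCommGroup M] [Module k M] [Module (MonoidAlgebra k G) M]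
  [IsScalarTower k (MonoidAlgebra k G) M]
  [AddCommGroup M'] [Module k M'] [Module (MonoidAlgebra k G) M']
  [IsScalarTower k (MonoidAlgebra k G) M']
  [AddCommGroup P] [Module k P] [Module (MonoidAlgebra k H) P]
  [IsScalarTower k (MonoidAlgebra k H) P]

theorem inl_smul_tmul (a : MonoidAlgebra k G) (m : M) (p : P) :
    ι₁ a • (m ⊗ₜ[k] p) = (a • m) ⊗ₜ[k] p := by
  induction a using MonoidAlgebra.induction_linear with
  | zero => simp
  | add x y hx hy => simp only [map_add, add_smul, hx, hy, add_tmul]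
  | single g r =>
    have : (single g r : MonoidAlgebra k G) = r • single g 1 := by simp
    rw [this, mapDomainRingHom_smul', smul_assoc, smul_assoc, mapDomainRingHom_apply,
      mapDomain_single, MonoidHom.inl_apply, single_one_smul_tmul, smul_tmul']

theorem inr_smul_tmul (b : MonoidAlgebra k H) (m : M) (p : P) :
    ι₂ b • (m ⊗ₜ[k] p) = m ⊗ₜ[k] (b • p) := by
  induction b using MonoidAlgebra.induction_linear with
  | zero => simp
  | add x y hx hy => simp only [map_add, add_smul, hx, hy, tmul_add]
  | single h r =>
    have : (single h r : MonoidAlgebra k H) = r • single h 1 := by simp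
    rw [this, mapDomainRingHom_smul', smul_assoc, smul_assoc, mapDomainRingHom_apply,
      mapDomain_single, MonoidHom.inr_apply, one_single_smul_tmul]
    exact (tmul_smul r m _).symm

theorem inl_smul (a : MonoidAlgebra k G) (x : M ⊗[k] P) : ι₁ a • x = a • x := by
  induction x with
  | zero => simp
  | add v w hv hw => simp only [smul_add, hv, hw]
  | tmul m p => rw [inl_smul_tmul, smul_tmul']

theorem regular_outerTensor_hom_ext {Y : Type u} [AddCommGroup Y]
    [Module (MonoidAlgebra k (G × H)) Y]
    {f g : M ⊗[k] MonoidAlgebra k H →ₗ[MonoidAlgebra k (G × H)] Y}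
    (h : ∀ m, f (m ⊗ₜ 1) = g (m ⊗ₜ 1)) : f = g :=
  outerTensor_hom_ext fun m b => by
    rw [← mul_one b, ← smul_eq_mul, ← inr_smul_tmul (G := G), map_smul, map_smul, h]

section Lift

variable {Y : Type u} [AddCommGroup Y] [Module k Y] [Module (MonoidAlgebra k (G × H)) Y]
  [IsScalarTower k (MonoidAlgebra k (G × H)) Y]

/-- `M ⊗ kH` is induced from `M`: extension of an equivariant map. -/
noncomputable def outerLift (φ : M →+ Y) (hφ : ∀ (a : MonoidAlgebra k G) m, φ (a • m) = ι₁ a • φ m) :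
    M ⊗[k] MonoidAlgebra k H →ₗ[MonoidAlgebra k (G × H)] Y :=
  equivariantOfLinearOfComm
    (TensorProduct.lift (LinearMap.mk₂ k (fun m b => ι₂ b • φ m)
      (fun m m' b => by rw [map_add, smul_add])
      (fun c m b => by
        rw [← algebraMap_smul (MonoidAlgebra k G) c m, hφ,
          ← algebraMap_smul (MonoidAlgebra k (G × H)) c, ← smul_assoc, ← smul_assoc, smul_eq_mul,
          smul_eq_mul, ← mapDomainRingHom_inl_mul_inr, Algebra.algebraMap_eq_smul_one,
          mapDomainRingHom_smul', map_one, ← Algebra.algebraMap_eq_smul_one])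
      (fun m b b' => by rw [map_add, add_smul])
      (fun c m b => by rw [mapDomainRingHom_smul', smul_assoc])))
    fun x v => by
      obtain ⟨g, h⟩ := x
      induction v with
      | zero => simp
      | add v w hv hw => simp only [smul_add, map_add, hv, hw]
      | tmul m b =>
        have hgh : (single (g, h) 1 : MonoidAlgebra k (G × H)) =
            ι₂ (single h 1) * ι₁ (single g 1) := by
          simp [mapDomain_single, single_mul_single]
        rw [single_smul_outerTensor_tmul, TensorProduct.lift.tmul, TensorProduct.lift.tmul,
          LinearMap.mk₂_apply, LinearMap.mk₂_apply, hφ, smul_eq_mul, map_mul, hgh, ← smul_assoc,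
          ← smul_assoc, smul_eq_mul, smul_eq_mul, mul_assoc, mul_assoc,
          mapDomainRingHom_inl_mul_inr]

theorem outerLift_tmul (φ : M →+ Y) (hφ : ∀ (a : MonoidAlgebra k G) m, φ (a • m) = ι₁ a • φ m)
    (m : M) (b : MonoidAlgebra k H) : outerLift φ hφ (m ⊗ₜ b) = ι₂ b • φ m := rfl

theorem IsInducedMod.nonempty_equiv {j : M →+ Y} (hj : IsInducedMod ι₁ M Y j) :
    Nonempty (Y ≃ₗ[MonoidAlgebra k (G × H)] M ⊗[k] MonoidAlgebra k H) := by
  obtain ⟨g, hg, -⟩ := hj.2 (M ⊗[k] MonoidAlgebra k H)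
    ((TensorProduct.mk k M (MonoidAlgebra k H)).flip 1).toAddMonoidHom
    (fun (a : MonoidAlgebra k G) m => (inl_smul_tmul a m (1 : MonoidAlgebra k H)).symm)
  refine ⟨LinearEquiv.ofLinearMap g (outerLift j hj.1) ?_ ?_⟩
  · refine regular_outerTensor_hom_ext fun m => ?_
    rw [LinearMap.comp_apply, outerLift_tmul, map_one, one_smul, hg]
    rfl
  · refine (hj.2 Y j hj.1).unique (fun m => ?_) (fun m => rfl)
    rw [LinearMap.comp_apply, hg]
    change outerLift j hj.1 (m ⊗ₜ 1) = _
    rw [outerLift_tmul, map_one, one_smul]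

end Lift

theorem nonempty_regular_equiv :
    Nonempty (MonoidAlgebra k (G × H) ≃ₗ[MonoidAlgebra k (G × H)]
      MonoidAlgebra k G ⊗[k] MonoidAlgebra k H) := by
  refine ⟨LinearEquiv.ofLinearMap (LinearMap.toSpanSingleton _ _ (1 ⊗ₜ 1))
    (outerLift (ι₁).toAddMonoidHom fun a m => map_mul (ι₁) a m) ?_ ?_⟩
  · refine regular_outerTensor_hom_ext fun a => ?_
    rw [LinearMap.comp_apply, outerLift_tmul, map_one, one_smul]
    change ι₁ a • ((1 : MonoidAlgebra k G) ⊗ₜ[k] (1 : MonoidAlgebra k H)) = a ⊗ₜ 1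
    rw [inl_smul_tmul, smul_eq_mul, mul_one]
  · refine LinearMap.ext_ring ?_
    rw [LinearMap.comp_apply, LinearMap.toSpanSingleton_apply, one_smul, outerLift_tmul, map_one,
      one_smul]
    exact map_one (ι₁)

theorem Module.Projective.regular_outerTensor (hM : Module.Projective (MonoidAlgebra k G) M) :
    Module.Projective (MonoidAlgebra k (G × H)) (M ⊗[k] MonoidAlgebra k H) := by
  refine Module.Projective.of_lifting_property'' fun f hf => ?_
  let _ : Module (MonoidAlgebra k G) (M ⊗[k] MonoidAlgebra k H →₀ MonoidAlgebra k (G × H)) :=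
    Module.compHom _ ι₁
  let f' : (M ⊗[k] MonoidAlgebra k H →₀ MonoidAlgebra k (G × H)) →ₗ[MonoidAlgebra k G]
      M ⊗[k] MonoidAlgebra k H :=
    { toFun := f
      map_add' := map_add f
      map_smul' := fun a y => (map_smul f (ι₁ a) y).trans (inl_smul a _) }
  obtain ⟨h, hh⟩ := Module.projective_lifting_property f'
    ((AlgebraTensorModule.mk k (MonoidAlgebra k G) M (MonoidAlgebra k H)).flip 1) hf
  have hφ : ∀ a m, h.toAddMonoidHom (a • m) = ι₁ a • h.toAddMonoidHom m := map_smul h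
  refine ⟨outerLift h.toAddMonoidHom hφ, regular_outerTensor_hom_ext fun m => ?_⟩
  rw [LinearMap.comp_apply, outerLift_tmul, map_one, one_smul]
  exact LinearMap.congr_fun hh m

theorem tensorContractRight_outerTensorMap_id (f : M →ₗ[MonoidAlgebra k G] M') (ξ : P →ₗ[k] k)
    (x : M ⊗[k] P) :
    tensorContractRight ξ (outerTensorMap f (LinearMap.id : P →ₗ[MonoidAlgebra k H] P) x) =
      f (tensorContractRight ξ x) := by
  induction x with
  | zero => simp
  | add v w hv hw => simp only [map_add, hv, hw]
  | tmul m p => simp [LinearMap.map_smul_of_tower]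

theorem eq_zero_of_tensorContractRight_eq_zero [FiniteDimensional k P] {x : M ⊗[k] P}
    (h : ∀ ξ, tensorContractRight ξ x = 0) : x = 0 := by
  rw [← sum_tensorContractRight_tmul (Module.finBasis k P) x]
  simp [h]

theorem eq_zero_of_sliceLeft_eq_zero {P' : Type u} [AddCommGroup P'] [Module k P']
    [Module (MonoidAlgebra k H) P'] [IsScalarTower k (MonoidAlgebra k H) P']
    [FiniteDimensional k P'] {f : M ⊗[k] P →ₗ[MonoidAlgebra k (G × H)] M' ⊗[k] P'}
    (h : ∀ p ξ, sliceLeft f p ξ = 0) : f = 0 :=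
  outerTensor_hom_ext fun m p => eq_zero_of_tensorContractRight_eq_zero fun ξ =>
    LinearMap.congr_fun (h p ξ) m

theorem isSuperfluous_ker_outerTensorMap [FiniteDimensional k P]
    {π : M →ₗ[MonoidAlgebra k G] M'} (hπ : IsSuperfluous (LinearMap.ker π)) :
    IsSuperfluous (LinearMap.ker (outerTensorMap π (LinearMap.id : P →ₗ[MonoidAlgebra k H] P))) := by
  intro U hU
  let b := Module.finBasis k P
  let S : Submodule (MonoidAlgebra k G) (M ⊗[k] P) := Finset.univ.sup fun i =>
    (LinearMap.ker π).map ((AlgebraTensorModule.mk k (MonoidAlgebra k G) M P).flip (b i))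
  have hS : IsSuperfluous S := IsSuperfluous.finset_sup _ _ fun i _ => hπ.map _
  let V : Submodule (MonoidAlgebra k G) (M ⊗[k] P) :=
    { U.toAddSubmonoid with
      smul_mem' := fun a x hx => by rw [← inl_smul (H := H)]; exact U.smul_mem _ hx }
  have hV : V = ⊤ := by
    refine hS V (eq_top_iff.2 fun x _ => ?_)
    obtain ⟨y, hy, z, hz, rfl⟩ := Submodule.mem_sup.1 (hU ▸ Submodule.mem_top : x ∈ U ⊔ _)
    refine add_mem (Submodule.mem_sup_left hy) (Submodule.mem_sup_right ?_)
    rw [← sum_tensorContractRight_tmul b z]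
    refine sum_mem fun i hi => (Finset.le_sup (f := fun i => (LinearMap.ker π).map
      ((AlgebraTensorModule.mk k (MonoidAlgebra k G) M P).flip (b i))) hi) ⟨_, ?_, rfl⟩
    rw [SetLike.mem_coe, LinearMap.mem_ker, ← tensorContractRight_outerTensorMap_id (H := H),
      LinearMap.mem_ker.1 hz, map_zero]
  exact eq_top_iff.2 fun x _ => (hV ▸ Submodule.mem_top : x ∈ V)

theorem IsProjCover.regular_outerTensor [Finite H] {π : M →ₗ[MonoidAlgebra k G] M'}
    (hπ : IsProjCover (MonoidAlgebra k G) π) :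
    IsProjCover (MonoidAlgebra k (G × H)) (outerTensorMap π
      (LinearMap.id : MonoidAlgebra k H →ₗ[MonoidAlgebra k H] MonoidAlgebra k H)) :=
  ⟨hπ.1.regular_outerTensor,
    TensorProduct.map_surjective hπ.2.1 Function.surjective_id,
    isSuperfluous_ker_outerTensorMap hπ.2.2⟩

theorem isTauRigid_outerTensor_of_isProjCover [Finite H] {P₀ P₁ : Type u}
    [AddCommGroup P₀] [Module k P₀] [Module (MonoidAlgebra k G) P₀]
    [IsScalarTower k (MonoidAlgebra k G) P₀]
    [AddCommGroup P₁] [Module k P₁] [Module (MonoidAlgebra k G) P₁]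
    [IsScalarTower k (MonoidAlgebra k G) P₁]
    {π₀ : P₀ →ₗ[MonoidAlgebra k G] M} (h₀ : IsProjCover (MonoidAlgebra k G) π₀)
    {π₁ : P₁ →ₗ[MonoidAlgebra k G] LinearMap.ker π₀} (h₁ : IsProjCover (MonoidAlgebra k G) π₁)
    (hM : IsTauRigid (MonoidAlgebra k G) M) :
    IsTauRigid (MonoidAlgebra k (G × H)) (M ⊗[k] MonoidAlgebra k H) := by
  refine isTauRigid_of_isProjCover _ h₀.regular_outerTensor
    (outerTensorMap (LinearMap.ker π₀).subtype LinearMap.id) ?_ ?_ _ h₁.regular_outerTensor ?_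
  · rw [injective_iff_map_eq_zero]
    refine fun x hx => eq_zero_of_tensorContractRight_eq_zero fun ξ => Subtype.ext ?_
    have := tensorContractRight_outerTensorMap_id (H := H) (LinearMap.ker π₀).subtype ξ x
    rw [hx, map_zero] at this
    exact this.symm
  · apply le_antisymm
    · rintro _ ⟨x, rfl⟩
      refine LinearMap.mem_ker.2 (eq_zero_of_tensorContractRight_eq_zero fun ξ => ?_)
      rw [tensorContractRight_outerTensorMap_id, tensorContractRight_outerTensorMap_id]
      exact (tensorContractRight ξ x).2
    · intro x hx
      let b := Module.finBasis k (MonoidAlgebra k H)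
      rw [← sum_tensorContractRight_tmul b x]
      refine sum_mem fun i _ => ⟨(⟨tensorContractRight (b.coord i) x, ?_⟩ :
        LinearMap.ker π₀) ⊗ₜ b i, rfl⟩
      rw [LinearMap.mem_ker, ← tensorContractRight_outerTensorMap_id (H := H),
        LinearMap.mem_ker.1 hx, map_zero]
  · intro g hg
    refine eq_zero_of_sliceLeft_eq_zero fun p ξ => ?_
    have hker : ∀ m, sliceLeft g p ξ m ∈ LinearMap.ker π₁ := fun m => by
      rw [LinearMap.mem_ker, sliceLeft_apply, ← tensorContractRight_outerTensorMap_id (H := H)]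
      have := LinearMap.congr_fun hg (m ⊗ₜ p)
      rw [LinearMap.comp_apply] at this
      rw [this, LinearMap.zero_apply, map_zero]
    have := hM P₀ π₀ h₀ P₁ π₁ h₁ ((sliceLeft g p ξ).codRestrict _ hker)
    ext m
    exact congrArg Subtype.val (LinearMap.congr_fun this m)

end RegularOuterTensor

theorem isSupportTauTilting_congr {R : Type u} [Ring R] {M N : Type u} [AddCommGroup M]
    [Module R M] [AddCommGroup N] [Module R N] (φ : N ≃ₗ[R] M) (h : IsSupportTauTilting R M) :
    IsSupportTauTilting R N := by
  obtain ⟨hM, P, hP, hPf, hPM, hcount⟩ := h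
  refine ⟨fun P₀ _ _ π₀ h₀ P₁ _ _ π₁ h₁ g => ?_, P, hP, hPf, fun f => ?_,
    by rw [numIndec_congr φ, hcount]⟩
  · have hker : LinearMap.ker (φ.toLinearMap ∘ₗ π₀) = LinearMap.ker π₀ := by
      ext x; simp
    let e := LinearEquiv.ofEq _ _ hker.symm
    have h₀' : IsProjCover R (φ.toLinearMap ∘ₗ π₀) :=
      ⟨h₀.1, φ.surjective.comp h₀.2.1, by rw [hker]; exact h₀.2.2⟩
    have hker₁ : LinearMap.ker (e.toLinearMap ∘ₗ π₁) = LinearMap.ker π₁ := by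
      ext x
      rw [LinearMap.mem_ker, LinearMap.comp_apply]
      exact e.map_eq_zero_iff
    have h₁' : IsProjCover R (e.toLinearMap ∘ₗ π₁) :=
      ⟨h₁.1, e.surjective.comp h₁.2.1, by rw [hker₁]; exact h₁.2.2⟩
    have := hM P₀ _ h₀' P₁ _ h₁'
      ((LinearEquiv.ofEq _ _ hker₁.symm).toLinearMap ∘ₗ g ∘ₗ φ.symm.toLinearMap)
    ext x
    have hx := congrArg Subtype.val (LinearMap.congr_fun this (φ x))
    simpa using hx
  · ext x
    simpa using LinearMap.congr_fun (hPM (φ.toLinearMap ∘ₗ f)) x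

/-- For arbitrary finite groups `G₁, G₂` and a support
τ-tilting `kG₁`-module `M`, the induced module
`Ind_{G₁}^{G₁ × G₂} M ≅ kG₂ ⊗ M` is a support τ-tilting
`k[G₁ × G₂]`-module. -/
theorem isSupportTauTilting_induced_prod
    (k : Type u) [Field k] [IsAlgClosed k] (p : ℕ) (hp : 0 < p) [CharP k p]
    (G₁ G₂ : Type u) [Group G₁] [Fintype G₁] [Group G₂] [Fintype G₂]
    (M : Type u) [AddCommGroup M] [Module (MonoidAlgebra k G₁) M]
    [Module.Finite (MonoidAlgebra k G₁) M]
    (hst : IsSupportTauTilting (MonoidAlgebra k G₁) M)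
    (N : Type u) [AddCommGroup N] [Module (MonoidAlgebra k (G₁ × G₂)) N]
    (jM : M →+ N)
    (hN : IsInducedMod (MonoidAlgebra.mapDomainRingHom k (MonoidHom.inl G₁ G₂))
      M N jM) :
    IsSupportTauTilting (MonoidAlgebra k (G₁ × G₂)) N := by
  obtain ⟨hτ, P, hP, hPf, hPM, hcount⟩ := hst
  have : IsArtinianRing (MonoidAlgebra k G₁) := IsArtinianRing.of_finite k _
  have : IsArtinianRing (MonoidAlgebra k G₂) := IsArtinianRing.of_finite k _
  have : IsArtinianRing (MonoidAlgebra k (G₁ × G₂)) := IsArtinianRing.of_finite k _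
  have tower : ∀ (G X : Type u) [Group G] [AddCommGroup X] [Module (MonoidAlgebra k G) X],
      letI : Module k X := Module.compHom X (algebraMap k (MonoidAlgebra k G))
      IsScalarTower k (MonoidAlgebra k G) X := fun G X _ _ _ =>
    letI : Module k X := Module.compHom X (algebraMap k (MonoidAlgebra k G))
    IsScalarTower.of_algebraMap_smul fun _ _ => rfl
  obtain ⟨P₀, π₀, hP₀, h₀⟩ := exists_isProjCover (R := MonoidAlgebra k G₁) M
  have : Module.Finite (MonoidAlgebra k G₁) (LinearMap.ker π₀) := inferInstance
  obtain ⟨P₁, π₁, hP₁, h₁⟩ := exists_isProjCover (R := MonoidAlgebra k G₁) (LinearMap.ker π₀)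
  let _ : Module k M := Module.compHom M (algebraMap k (MonoidAlgebra k G₁))
  let _ : Module k P := Module.compHom P (algebraMap k (MonoidAlgebra k G₁))
  let _ : Module k P₀ := Module.compHom P₀ (algebraMap k (MonoidAlgebra k G₁))
  let _ : Module k P₁ := Module.compHom P₁ (algebraMap k (MonoidAlgebra k G₁))
  let _ : Module k N := Module.compHom N (algebraMap k (MonoidAlgebra k (G₁ × G₂)))
  have := tower G₁ M
  have := tower G₁ P
  have := tower G₁ P₀
  have := tower G₁ P₁
  have := tower (G₁ × G₂) N
  have : Module.Finite k M := Module.Finite.trans (MonoidAlgebra k G₁) M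
  have : Module.Finite k P := Module.Finite.trans (MonoidAlgebra k G₁) P
  obtain ⟨φ⟩ := hN.nonempty_equiv
  obtain ⟨ψ⟩ := nonempty_regular_equiv (k := k) (G := G₁) (H := G₂)
  refine isSupportTauTilting_congr φ ⟨isTauRigid_outerTensor_of_isProjCover h₀ h₁ hτ,
    ModuleCat.of _ (TensorProduct k P (MonoidAlgebra k G₂)), hP.regular_outerTensor,
    Module.Finite.of_restrictScalars_finite k _ (TensorProduct k P (MonoidAlgebra k G₂)),
    fun f => eq_zero_of_sliceLeft_eq_zero fun p ξ => hPM _, ?_⟩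
  change _ + numIndec _ (TensorProduct k P (MonoidAlgebra k G₂)) = _
  rw [numIndec_outerTensor, numIndec_outerTensor, ← add_mul, hcount, numSimples_eq_numIndec,
    numSimples_eq_numIndec, numIndec_congr ψ, numIndec_outerTensor]
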